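/- Let K ⊆ Sym(3) be a non-empty compact set of real symmetric 3×3 matrices. Then the 1-symmetric div-quasiconvex hull coincides with the ∞-symmetric div-quasiconvex hull: K^(1) = K^(∞). -/

import Mathlib

/-!
Symmetric div-quasiconvex hulls of compact sets of symmetric 3×3 matrices.

`M33` encodes the real 3×3 matrices with the Frobenius norm, as the Euclidean
space indexed by `Fin 3 × Fin 3`; symmetric matrices are singled out by the
predicate `IsSym3`.  The torus `𝕋₃ = ℝ³/ℤ³` is encoded via `ℤ³`-periodic
functions on `ℝ³` (with the unit cube `unitBox` as fundamental domain, of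
measure one, so integrals over `unitBox` are the normalized torus integrals).
-/

noncomputable section
open MeasureTheory

/-- 3×3 real matrices with the Frobenius norm. -/
abbrev M33 : Type := EuclideanSpace ℝ (Fin 3 × Fin 3)

/-- The underlying space `ℝ³` of the torus `𝕋₃ = ℝ³/ℤ³`. -/
abbrev Dom3 : Type := Fin 3 → ℝ

/-- A 3×3 matrix is symmetric. -/
def IsSym3 (A : M33) : Prop := ∀ i j : Fin 3, A (i, j) = A (j, i)

/-- The fundamental domain `[0,1)³` of the torus. -/
def unitBox : Set Dom3 := Set.univ.pi fun _ => Set.Ico (0 : ℝ) 1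

/-- `ℤ³`-periodicity: the defining property of functions on the torus `𝕋₃`. -/
def PeriodicZ3 {E : Type*} (φ : Dom3 → E) : Prop :=
  ∀ (x : Dom3) (m : Fin 3 → ℤ), φ (x + fun i => (m i : ℝ)) = φ x

/-- Pointwise row-wise divergence-freeness of a (smooth) matrix field. -/
def DivFree3 (φ : Dom3 → M33) : Prop :=
  ∀ (x : Dom3) (α : Fin 3),
    ∑ β : Fin 3, fderiv ℝ (fun y => φ y (α, β)) x (Pi.single β 1) = 0

/-- The test class `𝒯`: smooth maps `φ : 𝕋₃ → Sym(3)` with zero mean and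
`div φ = 0` (row-wise). -/
def TestClass : Set (Dom3 → M33) :=
  {φ | ContDiff ℝ (⊤ : ℕ∞) φ ∧ PeriodicZ3 φ ∧ (∀ x, IsSym3 (φ x)) ∧ DivFree3 φ ∧
    (∫ x in unitBox, φ x) = 0}

/-- `F : Sym(3) → ℝ` is symmetric div-quasiconvex if
`F ξ ≤ ∫_{𝕋₃} F (ξ + φ x) dx` for all symmetric `ξ` and all `φ ∈ 𝒯`. -/
def SymDivQC (F : M33 → ℝ) : Prop :=
  ∀ ξ : M33, IsSym3 ξ → ∀ φ ∈ TestClass, F ξ ≤ ∫ x in unitBox, F (ξ + φ x)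

/-- The symmetric div-quasiconvex envelope
`𝒬F(ξ) = inf { ∫_{𝕋₃} F(ξ + φ(x)) dx : φ ∈ 𝒯 }`. -/
def sdqcEnvelope (F : M33 → ℝ) (ξ : M33) : ℝ :=
  sInf ((fun φ : Dom3 → M33 => ∫ x in unitBox, F (ξ + φ x)) '' TestClass)

/-- The `p`-symmetric div-quasiconvex hull
`K^(p) = { ξ ∈ Sym(3) : 𝒬f_p(ξ) = 0 }` with `f_p(ξ) = dist(ξ,K)^p`. -/
def hullP (K : Set M33) (p : ℝ) : Set M33 :=
  {ξ | IsSym3 ξ ∧ sdqcEnvelope (fun η => Metric.infDist η K ^ p) ξ = 0}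

/-- The `∞`-symmetric div-quasiconvex hull: all symmetric `ξ` with
`g ξ ≤ max_K g` for every symmetric div-quasiconvex continuous
`g : Sym(3) → [0,∞)`. -/
def hullInf (K : Set M33) : Set M33 :=
  {ξ | IsSym3 ξ ∧ ∀ g : M33 → ℝ, Continuous g → (∀ η, 0 ≤ g η) → SymDivQC g →
    g ξ ≤ sSup (g '' K)}

open Set

/-! ### Periodic functions and integrals over the unit cube -/

theorem unitBox_eq_fundamentalDomain :
    unitBox = ZSpan.fundamentalDomain (Pi.basisFun ℝ (Fin 3)) := by
  ext x
  simp [unitBox, ZSpan.mem_fundamentalDomain]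

theorem isAddFundamentalDomain_unitBox :
    IsAddFundamentalDomain (Submodule.span ℤ (range (Pi.basisFun ℝ (Fin 3)))).toAddSubgroup unitBox
      (volume : Measure Dom3) := by
  rw [unitBox_eq_fundamentalDomain]
  exact ZSpan.isAddFundamentalDomain' _ _

instance countable_integerLattice :
    Countable (Submodule.span ℤ (range (Pi.basisFun ℝ (Fin 3)))).toAddSubgroup :=
  inferInstanceAs (Countable (Submodule.span ℤ (range (Pi.basisFun ℝ (Fin 3)))))

theorem measurableSet_unitBox : MeasurableSet unitBox :=
  MeasurableSet.univ_pi fun _ => measurableSet_Ico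

theorem volume_unitBox : volume unitBox = 1 := by
  simp [unitBox, volume_pi, Measure.pi_pi]

instance isProbabilityMeasure_unitBox :
    IsProbabilityMeasure ((volume : Measure Dom3).restrict unitBox) :=
  ⟨by simp [volume_unitBox]⟩

theorem PeriodicZ3.vadd_eq {E : Type*} {f : Dom3 → E} (hf : PeriodicZ3 f)
    (g : (Submodule.span ℤ (range (Pi.basisFun ℝ (Fin 3)))).toAddSubgroup) (x : Dom3) :
    f (g +ᵥ x) = f x := by
  obtain ⟨g, hg⟩ := g
  obtain ⟨m, rfl⟩ := (Submodule.mem_span_range_iff_exists_fun ℤ).1 hg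
  have : (fun i => (m i : ℝ)) = ∑ i, m i • (Pi.basisFun ℝ (Fin 3)) i := by
    ext j
    simp [Pi.single_apply]
  rw [← hf x m, this, add_comm]
  rfl

theorem PeriodicZ3.setIntegral_add {E : Type*} [NormedAddCommGroup E] [NormedSpace ℝ E]
    {f : Dom3 → E} (hf : PeriodicZ3 f) (a : Dom3) :
    ∫ x in unitBox, f (a + x) = ∫ x in unitBox, f x := by
  have h1 := (isAddFundamentalDomain_unitBox.vadd_of_comm a).setIntegral_eq
    isAddFundamentalDomain_unitBox hf.vadd_eq
  rw [← h1]
  exact ((measurePreserving_add_left volume a).setIntegral_image_emb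
    (measurableEmbedding_addLeft a) f unitBox).symm

theorem PeriodicZ3.setLIntegral_add {f : Dom3 → ENNReal} (hf : PeriodicZ3 f) (a : Dom3) :
    ∫⁻ x in unitBox, f (a + x) = ∫⁻ x in unitBox, f x := by
  have h1 := (isAddFundamentalDomain_unitBox.vadd_of_comm a).setLIntegral_eq
    isAddFundamentalDomain_unitBox f hf.vadd_eq
  rw [← h1]
  exact (measurePreserving_add_left volume a).setLIntegral_comp_emb
    (measurableEmbedding_addLeft a) f unitBox

theorem sub_floor_mem_unitBox (x : Dom3) : (x - fun i => (⌊x i⌋ : ℝ)) ∈ unitBox := by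
  intro i _
  exact ⟨Int.fract_nonneg (x i), Int.fract_lt_one (x i)⟩

theorem PeriodicZ3.sub_floor {E : Type*} {f : Dom3 → E} (hf : PeriodicZ3 f) (x : Dom3) :
    f (x - fun i => (⌊x i⌋ : ℝ)) = f x := by
  simpa using (hf (x - fun i => (⌊x i⌋ : ℝ)) fun i => ⌊x i⌋).symm

theorem unitBox_subset_Icc : unitBox ⊆ Icc (0 : Dom3) 1 := fun _ hx =>
  ⟨fun i => (hx i trivial).1, fun i => (hx i trivial).2.le⟩

theorem PeriodicZ3.exists_bound {E : Type*} [NormedAddCommGroup E] {f : Dom3 → E}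
    (hf : PeriodicZ3 f) (hc : Continuous f) : ∃ C, 0 ≤ C ∧ ∀ x, ‖f x‖ ≤ C := by
  obtain ⟨C, hC⟩ := (isCompact_Icc (a := (0 : Dom3)) (b := 1)).exists_bound_of_continuousOn
    hc.continuousOn
  refine ⟨C, (norm_nonneg _).trans (hC 0 ⟨le_rfl, zero_le_one⟩), fun x => ?_⟩
  rw [← hf.sub_floor x]
  exact hC _ (unitBox_subset_Icc (sub_floor_mem_unitBox x))

/-! ### Weighted averages of translates -/

/-- The weighted average `x ↦ ∫ a(ω) f(x + e(ω)) dν(ω)` of translates of `f`. -/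
def tavg {Ω : Type*} [MeasurableSpace Ω] (ν : Measure Ω) (a : Ω → ℝ) (e : Ω → Dom3)
    {E : Type*} [NormedAddCommGroup E] [NormedSpace ℝ E] (f : Dom3 → E) (x : Dom3) : E :=
  ∫ ω, a ω • f (x + e ω) ∂ν

section tavg

variable {Ω : Type*} [MeasurableSpace Ω] {ν : Measure Ω} {a : Ω → ℝ}
  {e : Ω → Dom3} {A : ℝ} {E : Type*} [NormedAddCommGroup E] [NormedSpace ℝ E]

theorem PeriodicZ3.fderiv {f : Dom3 → E} (hf : PeriodicZ3 f) : PeriodicZ3 (fderiv ℝ f) := by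
  intro x m
  rw [← fderiv_comp_add_right]
  congr 1
  funext y
  exact hf y m

theorem PeriodicZ3.tavg {f : Dom3 → E} (hf : PeriodicZ3 f) : PeriodicZ3 (tavg ν a e f) := by
  intro x m
  simp only [_root_.tavg]
  congr 1
  funext ω
  rw [add_right_comm, hf]

theorem aestronglyMeasurable_tavg (ha : Measurable a) (he : Measurable e) {f : Dom3 → E}
    (hc : Continuous f) (x : Dom3) : AEStronglyMeasurable (fun ω => a ω • f (x + e ω)) ν :=
  ha.aestronglyMeasurable.smul
    (hc.comp_aestronglyMeasurable (measurable_const.add he).aestronglyMeasurable)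

theorem integrable_tavg [IsFiniteMeasure ν] (ha : Measurable a) (hA : ∀ ω, |a ω| ≤ A)
    (he : Measurable e) {f : Dom3 → E} (hf : PeriodicZ3 f) (hc : Continuous f) (x : Dom3) :
    Integrable (fun ω => a ω • f (x + e ω)) ν := by
  obtain ⟨C, hC0, hC⟩ := hf.exists_bound hc
  refine Integrable.of_bound (aestronglyMeasurable_tavg ha he hc x) (A * C)
    (Filter.Eventually.of_forall fun ω => ?_)
  rw [norm_smul]
  exact mul_le_mul (hA ω) (hC _) (norm_nonneg _) ((abs_nonneg _).trans (hA ω))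

theorem hasFDerivAt_tavg [IsFiniteMeasure ν] (ha : Measurable a) (hA : ∀ ω, |a ω| ≤ A)
    (he : Measurable e) {f : Dom3 → E} (hf : PeriodicZ3 f) (hc : ContDiff ℝ 1 f) (x : Dom3) :
    HasFDerivAt (tavg ν a e f) (tavg ν a e (fderiv ℝ f) x) x := by
  have hc' : Continuous (fderiv ℝ f) := hc.continuous_fderiv one_ne_zero
  obtain ⟨C, hC0, hC⟩ := hf.fderiv.exists_bound hc'
  refine hasFDerivAt_integral_of_dominated_of_fderiv_le (s := univ) (bound := fun _ => A * C)
    (F' := fun x ω => a ω • fderiv ℝ f (x + e ω)) Filter.univ_mem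
    (Filter.Eventually.of_forall fun y => aestronglyMeasurable_tavg ha he hc.continuous y)
    (integrable_tavg ha hA he hf hc.continuous x)
    (aestronglyMeasurable_tavg ha he hc' x)
    (Filter.Eventually.of_forall fun ω y _ => ?_) (integrable_const _)
    (Filter.Eventually.of_forall fun ω y _ => ?_)
  · rw [norm_smul]
    exact mul_le_mul (hA ω) (hC _) (norm_nonneg _) ((abs_nonneg _).trans (hA ω))
  · exact ((hasFDerivAt_comp_add_right (e ω)).2
      ((hc.differentiable one_ne_zero) (y + e ω)).hasFDerivAt).const_smul (a ω)

end tavg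

theorem contDiff_nat_tavg {Ω : Type*} [MeasurableSpace Ω] {ν : Measure Ω} [IsFiniteMeasure ν]
    {a : Ω → ℝ} {e : Ω → Dom3} {A : ℝ} (ha : Measurable a) (hA : ∀ ω, |a ω| ≤ A)
    (he : Measurable e) (n : ℕ) {E : Type} [NormedAddCommGroup E] [NormedSpace ℝ E]
    {f : Dom3 → E} (hf : PeriodicZ3 f) (hc : ContDiff ℝ (⊤ : ℕ∞) f) :
    ContDiff ℝ n (tavg ν a e f) := by
  induction n generalizing E with
  | zero =>
    refine contDiff_zero.2 (Differentiable.continuous (𝕜 := ℝ) fun x => ?_)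
    exact (hasFDerivAt_tavg ha hA he hf (hc.of_le (by exact_mod_cast le_top)) x).differentiableAt
  | succ n ih =>
    exact contDiff_succ_iff_hasFDerivAt.2 ⟨_, ih hf.fderiv (contDiff_infty_iff_fderiv.1 hc).2,
      hasFDerivAt_tavg ha hA he hf (hc.of_le (by exact_mod_cast le_top))⟩

/-! ### Smooth periodic functions -/

/-- Smooth functions on the torus. -/
def SmoothPeriodic (f : Dom3 → ℝ) : Prop := ContDiff ℝ (⊤ : ℕ∞) f ∧ PeriodicZ3 f

/-- Partial derivatives. -/
def pd (k : Fin 3) (f : Dom3 → ℝ) (x : Dom3) : ℝ := fderiv ℝ f x (Pi.single k 1)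

namespace SmoothPeriodic

variable {f g : Dom3 → ℝ}

theorem continuous (hf : SmoothPeriodic f) : Continuous f := hf.1.continuous

theorem differentiable (hf : SmoothPeriodic f) : Differentiable ℝ f :=
  hf.1.differentiable (by simp)

theorem const (c : ℝ) : SmoothPeriodic fun _ => c := ⟨contDiff_const, fun _ _ => rfl⟩

theorem add (hf : SmoothPeriodic f) (hg : SmoothPeriodic g) :
    SmoothPeriodic fun x => f x + g x :=
  ⟨hf.1.add hg.1, fun x m => by simp only [hf.2 x m, hg.2 x m]⟩

theorem sub (hf : SmoothPeriodic f) (hg : SmoothPeriodic g) :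
    SmoothPeriodic fun x => f x - g x :=
  ⟨hf.1.sub hg.1, fun x m => by simp only [hf.2 x m, hg.2 x m]⟩

theorem mul (hf : SmoothPeriodic f) (hg : SmoothPeriodic g) :
    SmoothPeriodic fun x => f x * g x :=
  ⟨hf.1.mul hg.1, fun x m => by simp only [hf.2 x m, hg.2 x m]⟩

theorem sum {ι : Type*} {s : Finset ι} {f : ι → Dom3 → ℝ}
    (hf : ∀ i ∈ s, SmoothPeriodic (f i)) : SmoothPeriodic fun x => ∑ i ∈ s, f i x :=
  ⟨ContDiff.sum fun i hi => (hf i hi).1,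
    fun x m => Finset.sum_congr rfl fun i hi => (hf i hi).2 x m⟩

theorem pd (hf : SmoothPeriodic f) (k : Fin 3) : SmoothPeriodic (pd k f) :=
  ⟨(contDiff_infty_iff_fderiv.1 hf.1).2.clm_apply contDiff_const,
    fun x m => by simp only [_root_.pd, hf.2.fderiv x m]⟩

theorem exists_bound (hf : SmoothPeriodic f) : ∃ C, 0 ≤ C ∧ ∀ x, |f x| ≤ C :=
  hf.2.exists_bound hf.continuous

theorem tavg {Ω : Type*} [MeasurableSpace Ω] {ν : Measure Ω} [IsFiniteMeasure ν]
    {a : Ω → ℝ} {e : Ω → Dom3} {A : ℝ} (hf : SmoothPeriodic f) (ha : Measurable a)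
    (hA : ∀ ω, |a ω| ≤ A) (he : Measurable e) : SmoothPeriodic (tavg ν a e f) :=
  ⟨contDiff_infty.2 fun n => contDiff_nat_tavg ha hA he n hf.2 hf.1, hf.2.tavg⟩

theorem comp_smul_add (hf : SmoothPeriodic f) (n : ℕ) (s : Dom3) :
    SmoothPeriodic fun x => f ((n : ℝ) • x + s) := by
  refine ⟨hf.1.comp ((contDiff_id.const_smul (n : ℝ)).add contDiff_const), fun x m => ?_⟩
  change f _ = f _
  rw [← hf.2 ((n : ℝ) • x + s) fun i => n * m i]
  congr 1
  ext i
  simp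
  ring

end SmoothPeriodic

section pd

variable {f g : Dom3 → ℝ}

theorem pd_add (hf : SmoothPeriodic f) (hg : SmoothPeriodic g) (k : Fin 3) (x : Dom3) :
    pd k (fun y => f y + g y) x = pd k f x + pd k g x := by
  simp only [pd]
  rw [fderiv_fun_add (hf.differentiable x) (hg.differentiable x)]
  rfl

theorem pd_sub (hf : SmoothPeriodic f) (hg : SmoothPeriodic g) (k : Fin 3) (x : Dom3) :
    pd k (fun y => f y - g y) x = pd k f x - pd k g x := by
  simp only [pd]
  rw [fderiv_fun_sub (hf.differentiable x) (hg.differentiable x)]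
  rfl

theorem pd_neg (f : Dom3 → ℝ) (k : Fin 3) (x : Dom3) : pd k (fun y => -f y) x = -pd k f x := by
  simp only [pd]
  rw [fderiv_fun_neg]
  rfl

theorem pd_mul (hf : SmoothPeriodic f) (hg : SmoothPeriodic g) (k : Fin 3) (x : Dom3) :
    pd k (fun y => f y * g y) x = pd k f x * g x + f x * pd k g x := by
  simp only [pd]
  rw [fderiv_fun_mul (hf.differentiable x) (hg.differentiable x)]
  simp
  ring

theorem pd_const_mul (hf : SmoothPeriodic f) (c : ℝ) (k : Fin 3) (x : Dom3) :
    pd k (fun y => c * f y) x = c * pd k f x := by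
  simp only [pd]
  rw [fderiv_const_mul (hf.differentiable x)]
  rfl

theorem pd_sum {ι : Type*} {s : Finset ι} {f : ι → Dom3 → ℝ}
    (hf : ∀ i ∈ s, SmoothPeriodic (f i)) (k : Fin 3) (x : Dom3) :
    pd k (fun y => ∑ i ∈ s, f i y) x = ∑ i ∈ s, pd k (f i) x := by
  simp only [pd]
  rw [fderiv_fun_sum fun i hi => (hf i hi).differentiable x]
  simp

theorem pd_comm (hf : SmoothPeriodic f) (k l : Fin 3) : pd k (pd l f) = pd l (pd k f) := by
  funext x
  have hd : DifferentiableAt ℝ (fderiv ℝ f) x :=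
    (contDiff_infty_iff_fderiv.1 hf.1).2.differentiable (by simp) x
  have key : ∀ i j : Fin 3, pd i (pd j f) x
      = fderiv ℝ (fderiv ℝ f) x (Pi.single i 1) (Pi.single j 1) := by
    intro i j
    rw [pd, show pd j f = fun y => fderiv ℝ f y (Pi.single j 1) from rfl,
      fderiv_clm_apply hd (differentiableAt_const _)]
    simp
  rw [key, key]
  exact (hf.1.contDiffAt.isSymmSndFDerivAt
    (by simpa using (WithTop.coe_le_coe.2 le_top : ((2 : ℕ∞) : WithTop ℕ∞) ≤ (⊤ : ℕ∞)))).eq _ _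

theorem pd_tavg {Ω : Type*} [MeasurableSpace Ω] {ν : Measure Ω} [IsFiniteMeasure ν]
    {a : Ω → ℝ} {e : Ω → Dom3} {A : ℝ} (hf : SmoothPeriodic f) (ha : Measurable a)
    (hA : ∀ ω, |a ω| ≤ A) (he : Measurable e) (k : Fin 3) :
    pd k (tavg ν a e f) = tavg ν a e (pd k f) := by
  funext x
  have hc : ContDiff ℝ 1 f := hf.1.of_le (by exact_mod_cast le_top)
  rw [pd, (hasFDerivAt_tavg ha hA he hf.2 hc x).fderiv, tavg, tavg,
    ContinuousLinearMap.integral_apply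
      (integrable_tavg ha hA he hf.2.fderiv (hc.continuous_fderiv one_ne_zero) x)]
  rfl

theorem pd_comp_smul_add (hf : SmoothPeriodic f) (n : ℕ) (s : Dom3) (k : Fin 3) (x : Dom3) :
    pd k (fun y => f ((n : ℝ) • y + s)) x = n * pd k f ((n : ℝ) • x + s) := by
  have h1 : HasFDerivAt (fun y : Dom3 => (n : ℝ) • y + s)
      ((n : ℝ) • ContinuousLinearMap.id ℝ Dom3) x :=
    ((hasFDerivAt_id x).const_smul (n : ℝ)).add_const s
  have h2 := (hf.differentiable ((n : ℝ) • x + s)).hasFDerivAt.comp x h1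
  rw [pd, show (fun y => f ((n : ℝ) • y + s)) = f ∘ fun y => (n : ℝ) • y + s from rfl, h2.fderiv]
  simp [pd]

theorem pd_congr_of_eventuallyEq {x : Dom3} (h : f =ᶠ[nhds x] g) (k : Fin 3) :
    pd k f =ᶠ[nhds x] pd k g := by
  filter_upwards [h.fderiv (𝕜 := ℝ)] with y hy
  rw [pd, pd, hy]

theorem setIntegral_pd (hf : SmoothPeriodic f) (k : Fin 3) : ∫ x in unitBox, pd k f x = 0 := by
  have h1 : tavg (volume.restrict unitBox) (fun _ => 1) id f
      = fun _ => ∫ x in unitBox, f x := by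
    funext x
    simpa [tavg] using hf.2.setIntegral_add x
  have h2 := congrFun (pd_tavg (ν := volume.restrict unitBox) (a := fun _ => 1) (e := id) (A := 1)
    hf measurable_const (by simp) measurable_id k) 0
  rw [h1] at h2
  simpa [tavg, pd] using h2.symm

end pd

/-! ### Stress fields and their potentials -/

/-- Smooth periodic symmetric divergence-free matrix fields, given by their components. -/
structure StressField (u : Fin 3 → Fin 3 → Dom3 → ℝ) : Prop where
  smooth : ∀ i j, SmoothPeriodic (u i j)
  symm : ∀ i j, u i j = u j i
  div : ∀ i x, ∑ j, pd j (u i j) x = 0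

/-- Smooth periodic tensor fields with the symmetries of a curvature tensor (up to the Bianchi
identity). -/
structure IsPotential (R : Fin 3 → Fin 3 → Fin 3 → Fin 3 → Dom3 → ℝ) : Prop where
  smooth : ∀ i k j l, SmoothPeriodic (R i k j l)
  anti : ∀ i k j l, R i k j l = fun x => -R k i j l x
  pair : ∀ i k j l, R i k j l = R j l i k

/-- The double divergence of a potential. -/
def ddiv (R : Fin 3 → Fin 3 → Fin 3 → Fin 3 → Dom3 → ℝ) (i j : Fin 3) (x : Dom3) : ℝ :=
  ∑ k, ∑ l, pd k (pd l (R i k j l)) x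

namespace IsPotential

variable {R S : Fin 3 → Fin 3 → Fin 3 → Fin 3 → Dom3 → ℝ}

theorem anti_right (hR : IsPotential R) (i k j l : Fin 3) :
    R i k j l = fun x => -R i k l j x := by
  rw [hR.pair i k j l, hR.anti j l i k, hR.pair l j i k]

theorem smooth_ddiv (hR : IsPotential R) (i j : Fin 3) : SmoothPeriodic (ddiv R i j) :=
  SmoothPeriodic.sum fun k _ => SmoothPeriodic.sum fun l _ => ((hR.smooth i k j l).pd l).pd k

theorem stressField_ddiv (hR : IsPotential R) : StressField (ddiv R) where
  smooth := hR.smooth_ddiv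
  symm i j := by
    funext x
    rw [ddiv, ddiv, Finset.sum_comm]
    refine Finset.sum_congr rfl fun k _ => Finset.sum_congr rfl fun l _ => ?_
    rw [hR.pair i l j k, pd_comm (hR.smooth j k i l)]
  div i x := by
    have hsm : ∀ j k l, SmoothPeriodic (pd k (pd l (R i k j l))) :=
      fun j k l => ((hR.smooth i k j l).pd l).pd k
    have h1 : ∀ j, pd j (ddiv R i j) x = ∑ k, ∑ l, pd j (pd k (pd l (R i k j l))) x := by
      intro j
      rw [show ddiv R i j = fun y => ∑ k, ∑ l, pd k (pd l (R i k j l)) y from rfl,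
        pd_sum fun k _ => SmoothPeriodic.sum fun l _ => hsm j k l]
      exact Finset.sum_congr rfl fun k _ => pd_sum (fun l _ => hsm j k l) j x
    have h2 : ∀ j k l, pd j (pd k (pd l (R i k j l))) x = -pd l (pd k (pd j (R i k l j))) x := by
      intro j k l
      rw [hR.anti_right i k j l]
      have e1 : pd l (fun x => -R i k l j x) = fun x => -pd l (R i k l j) x :=
        funext fun x => pd_neg _ _ _
      have e2 : pd k (fun x => -pd l (R i k l j) x) = fun x => -pd k (pd l (R i k l j)) x :=
        funext fun x => pd_neg _ _ _
      rw [e1, e2, pd_neg, pd_comm (hR.smooth i k l j) k l, pd_comm ((hR.smooth i k l j).pd k) j l,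
        pd_comm (hR.smooth i k l j) j k]
    simp only [h1]
    have h3 : ∑ j, ∑ k, ∑ l, pd j (pd k (pd l (R i k j l))) x
        = -∑ j, ∑ k, ∑ l, pd j (pd k (pd l (R i k j l))) x := by
      refine (Finset.sum_congr rfl fun j _ => Finset.sum_congr rfl fun k _ =>
        Finset.sum_congr rfl fun l _ => h2 j k l).trans ?_
      simp only [Finset.sum_neg_distrib]
      congr 1
      rw [Finset.sum_comm]
      conv_rhs => rw [Finset.sum_comm]
      refine Finset.sum_congr rfl fun k _ => ?_
      rw [Finset.sum_comm]
    linarith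

theorem setIntegral_ddiv (hR : IsPotential R) (i j : Fin 3) :
    ∫ x in unitBox, ddiv R i j x = 0 := by
  have hint : ∀ k l, Integrable (pd k (pd l (R i k j l))) (volume.restrict unitBox) := by
    intro k l
    obtain ⟨C, -, hC⟩ := (((hR.smooth i k j l).pd l).pd k).exists_bound
    exact Integrable.of_bound (((hR.smooth i k j l).pd l).pd k).continuous.aestronglyMeasurable C
      (Filter.Eventually.of_forall hC)
  simp only [ddiv]
  rw [integral_finsetSum _ fun k _ => integrable_finsetSum _ fun l _ => hint k l]
  refine Finset.sum_eq_zero fun k _ => ?_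
  rw [integral_finsetSum _ fun l _ => hint k l]
  exact Finset.sum_eq_zero fun l _ => setIntegral_pd ((hR.smooth i k j l).pd l) k

theorem add (hR : IsPotential R) (hS : IsPotential S) :
    IsPotential fun i k j l x => R i k j l x + S i k j l x where
  smooth i k j l := (hR.smooth i k j l).add (hS.smooth i k j l)
  anti i k j l := by rw [hR.anti, hS.anti]; funext x; ring
  pair i k j l := by rw [hR.pair, hS.pair]

theorem sub (hR : IsPotential R) (hS : IsPotential S) :
    IsPotential fun i k j l x => R i k j l x - S i k j l x where
  smooth i k j l := (hR.smooth i k j l).sub (hS.smooth i k j l)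
  anti i k j l := by rw [hR.anti, hS.anti]; funext x; ring
  pair i k j l := by rw [hR.pair, hS.pair]

theorem mul (hR : IsPotential R) {χ : Dom3 → ℝ} (hχ : SmoothPeriodic χ) :
    IsPotential fun i k j l x => χ x * R i k j l x where
  smooth i k j l := hχ.mul (hR.smooth i k j l)
  anti i k j l := by rw [hR.anti]; funext x; ring
  pair i k j l := by rw [hR.pair]

theorem sum {ι : Type*} {s : Finset ι} {R : ι → Fin 3 → Fin 3 → Fin 3 → Fin 3 → Dom3 → ℝ}
    (hR : ∀ a ∈ s, IsPotential (R a)) : IsPotential fun i k j l x => ∑ a ∈ s, R a i k j l x where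
  smooth i k j l := SmoothPeriodic.sum fun a ha => (hR a ha).smooth i k j l
  anti i k j l := by
    funext x
    rw [← Finset.sum_neg_distrib]
    exact Finset.sum_congr rfl fun a ha => congrFun ((hR a ha).anti i k j l) x
  pair i k j l := by
    funext x
    exact Finset.sum_congr rfl fun a ha => congrFun ((hR a ha).pair i k j l) x

theorem comp_smul_add (hR : IsPotential R) (n : ℕ) (s : Dom3) :
    IsPotential fun i k j l x => R i k j l ((n : ℝ) • x + s) where
  smooth i k j l := (hR.smooth i k j l).comp_smul_add n s
  anti i k j l := by rw [hR.anti]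
  pair i k j l := by rw [hR.pair]

theorem ddiv_add (hR : IsPotential R) (hS : IsPotential S) (i j : Fin 3) (x : Dom3) :
    ddiv (fun i k j l x => R i k j l x + S i k j l x) i j x = ddiv R i j x + ddiv S i j x := by
  simp only [ddiv, ← Finset.sum_add_distrib]
  refine Finset.sum_congr rfl fun k _ => Finset.sum_congr rfl fun l _ => ?_
  rw [show pd l (fun x => R i k j l x + S i k j l x)
      = fun x => pd l (R i k j l) x + pd l (S i k j l) x from
    funext fun x => pd_add (hR.smooth i k j l) (hS.smooth i k j l) l x,
    pd_add ((hR.smooth i k j l).pd l) ((hS.smooth i k j l).pd l)]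

theorem ddiv_sub (hR : IsPotential R) (hS : IsPotential S) (i j : Fin 3) (x : Dom3) :
    ddiv (fun i k j l x => R i k j l x - S i k j l x) i j x = ddiv R i j x - ddiv S i j x := by
  simp only [ddiv, ← Finset.sum_sub_distrib]
  refine Finset.sum_congr rfl fun k _ => Finset.sum_congr rfl fun l _ => ?_
  rw [show pd l (fun x => R i k j l x - S i k j l x)
      = fun x => pd l (R i k j l) x - pd l (S i k j l) x from
    funext fun x => pd_sub (hR.smooth i k j l) (hS.smooth i k j l) l x,
    pd_sub ((hR.smooth i k j l).pd l) ((hS.smooth i k j l).pd l)]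

theorem ddiv_sum {ι : Type*} {s : Finset ι}
    {R : ι → Fin 3 → Fin 3 → Fin 3 → Fin 3 → Dom3 → ℝ} (hR : ∀ a ∈ s, IsPotential (R a))
    (i j : Fin 3) (x : Dom3) :
    ddiv (fun i k j l x => ∑ a ∈ s, R a i k j l x) i j x = ∑ a ∈ s, ddiv (R a) i j x := by
  have h1 : ∀ k l, pd k (pd l fun x => ∑ a ∈ s, R a i k j l x) x
      = ∑ a ∈ s, pd k (pd l (R a i k j l)) x := by
    intro k l
    rw [show pd l (fun x => ∑ a ∈ s, R a i k j l x) = fun x => ∑ a ∈ s, pd l (R a i k j l) x from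
      funext fun x => pd_sum (fun a ha => (hR a ha).smooth i k j l) l x]
    exact pd_sum (fun a ha => ((hR a ha).smooth i k j l).pd l) k x
  simp only [ddiv, h1]
  conv_rhs => rw [Finset.sum_comm]
  refine Finset.sum_congr rfl fun k _ => ?_
  exact Finset.sum_comm

theorem ddiv_mul (hR : IsPotential R) {χ : Dom3 → ℝ} (hχ : SmoothPeriodic χ) (i j : Fin 3)
    (x : Dom3) :
    ddiv (fun i k j l x => χ x * R i k j l x) i j x = χ x * ddiv R i j x
      + ∑ k, ∑ l, (pd k (pd l χ) x * R i k j l x + pd l χ x * pd k (R i k j l) x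
        + pd k χ x * pd l (R i k j l) x) := by
  simp only [ddiv, Finset.mul_sum, ← Finset.sum_add_distrib]
  refine Finset.sum_congr rfl fun k _ => Finset.sum_congr rfl fun l _ => ?_
  have hr := hR.smooth i k j l
  rw [show pd l (fun x => χ x * R i k j l x)
      = fun x => pd l χ x * R i k j l x + χ x * pd l (R i k j l) x from
    funext fun x => pd_mul hχ hr l x,
    pd_add ((hχ.pd l).mul hr) (hχ.mul (hr.pd l)), pd_mul (hχ.pd l) hr, pd_mul hχ (hr.pd l)]
  ring

end IsPotential

/-- The matrix field with given components. -/
def matrixField (u : Fin 3 → Fin 3 → Dom3 → ℝ) (x : Dom3) : M33 :=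
  WithLp.toLp 2 fun p => u p.1 p.2 x

theorem contDiff_matrixField {u : Fin 3 → Fin 3 → Dom3 → ℝ}
    (hu : ∀ i j, SmoothPeriodic (u i j)) : ContDiff ℝ (⊤ : ℕ∞) (matrixField u) :=
  contDiff_euclidean.2 fun p => (hu p.1 p.2).1

theorem integrable_unitBox {E : Type*} [NormedAddCommGroup E] {f : Dom3 → E}
    (hf : PeriodicZ3 f) (hc : Continuous f) : Integrable f (volume.restrict unitBox) := by
  obtain ⟨C, -, hC⟩ := hf.exists_bound hc
  have : SecondCountableTopologyEither Dom3 E := inferInstance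
  exact Integrable.of_bound hc.aestronglyMeasurable C (Filter.Eventually.of_forall hC)

theorem setIntegral_matrix_apply {φ : Dom3 → M33} (hφ : PeriodicZ3 φ) (hc : Continuous φ)
    (p : Fin 3 × Fin 3) : (∫ x in unitBox, φ x) p = ∫ x in unitBox, φ x p :=
  ((EuclideanSpace.proj (𝕜 := ℝ) p).integral_comp_comm (integrable_unitBox hφ hc)).symm

theorem mem_testClass_iff {φ : Dom3 → M33} :
    φ ∈ TestClass ↔ ∃ u, StressField u ∧ (∀ i j, ∫ x in unitBox, u i j x = 0) ∧
      φ = matrixField u := by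
  constructor
  · rintro ⟨h1, h2, h3, h4, h5⟩
    refine ⟨fun i j x => φ x (i, j), ⟨fun i j => ⟨contDiff_euclidean.1 h1 (i, j), fun x m => ?_⟩,
      fun i j => funext fun x => h3 x i j, fun i x => h4 x i⟩, fun i j => ?_, rfl⟩
    · simp only [h2 x m]
    · rw [← setIntegral_matrix_apply h2 h1.continuous, h5]
      rfl
  · rintro ⟨u, hu, hm, rfl⟩
    have hp : PeriodicZ3 (matrixField u) := by
      intro x m
      ext p
      exact (hu.smooth p.1 p.2).2 x m
    refine ⟨contDiff_matrixField hu.smooth, hp, fun x i j => congrFun (hu.symm i j) x,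
      fun x i => hu.div i x, ?_⟩
    ext p
    rw [setIntegral_matrix_apply hp (contDiff_matrixField hu.smooth).continuous]
    exact hm p.1 p.2

theorem StressField.add {u v : Fin 3 → Fin 3 → Dom3 → ℝ} (hu : StressField u)
    (hv : StressField v) : StressField fun i j x => u i j x + v i j x where
  smooth i j := (hu.smooth i j).add (hv.smooth i j)
  symm i j := by rw [hu.symm, hv.symm]
  div i x := by
    simp only [fun j => pd_add (hu.smooth i j) (hv.smooth i j) j x, Finset.sum_add_distrib,
      hu.div, hv.div, add_zero]

theorem add_ddiv_mem_testClass {φ : Dom3 → M33} (hφ : φ ∈ TestClass)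
    {R : Fin 3 → Fin 3 → Fin 3 → Fin 3 → Dom3 → ℝ} (hR : IsPotential R) :
    (fun x => φ x + matrixField (ddiv R) x) ∈ TestClass := by
  obtain ⟨u, hu, hm, rfl⟩ := mem_testClass_iff.1 hφ
  refine mem_testClass_iff.2 ⟨_, hu.add hR.stressField_ddiv, fun i j => ?_, rfl⟩
  rw [integral_add (integrable_unitBox (hu.smooth i j).2 (hu.smooth i j).continuous)
    (integrable_unitBox (hR.smooth_ddiv i j).2 (hR.smooth_ddiv i j).continuous), hm,
    hR.setIntegral_ddiv, add_zero]

/-! ### The homotopy between averages of a stress field -/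

theorem fderiv_apply_eq_sum (f : Dom3 → ℝ) (y e : Dom3) :
    fderiv ℝ f y e = ∑ p, e p * pd p f y := by
  have he : e = ∑ p, e p • (Pi.single p 1 : Dom3) := by
    ext i
    simp [Finset.sum_apply, Pi.single_apply]
  conv_lhs => rw [he]
  simp [pd]

theorem SmoothPeriodic.hasDerivAt_line {f : Dom3 → ℝ} (hf : SmoothPeriodic f) (x e : Dom3)
    (t : ℝ) :
    HasDerivAt (fun t : ℝ => f (x + t • e)) (∑ p, e p * _root_.pd p f (x + t • e)) t := by
  have h1 : HasDerivAt (fun t : ℝ => x + t • e) ((1 : ℝ) • e) t :=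
    ((hasDerivAt_id t).smul_const e).const_add x
  have h2 := (hf.differentiable (x + t • e)).hasFDerivAt.comp_hasDerivAt t h1
  rwa [one_smul, fderiv_apply_eq_sum] at h2

theorem SmoothPeriodic.taylor {f : Dom3 → ℝ} (hf : SmoothPeriodic f) (x e : Dom3) :
    ∫ t in Ioc (0 : ℝ) 1, max 0 (1 - |t|) *
        ∑ p, ∑ q, e p * e q * _root_.pd p (_root_.pd q f) (x + t • e)
      = f (x + e) - f x - ∑ p, e p * _root_.pd p f x := by
  have hL : SmoothPeriodic fun y => ∑ q, e q * _root_.pd q f y :=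
    SmoothPeriodic.sum fun q _ => (SmoothPeriodic.const (e q)).mul (hf.pd q)
  have hpL : ∀ p y, _root_.pd p (fun y => ∑ q, e q * _root_.pd q f y) y
      = ∑ q, e q * _root_.pd p (_root_.pd q f) y := by
    intro p y
    rw [pd_sum fun q _ => (SmoothPeriodic.const (e q)).mul (hf.pd q)]
    exact Finset.sum_congr rfl fun q _ => pd_const_mul (hf.pd q) _ _ _
  have hder : ∀ t : ℝ, HasDerivAt
      (fun t : ℝ => (1 - t) * (∑ q, e q * _root_.pd q f (x + t • e)) + f (x + t • e))
      ((1 - t) * ∑ p, ∑ q, e p * e q * _root_.pd p (_root_.pd q f) (x + t • e)) t := by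
    intro t
    refine ((((hasDerivAt_id t).const_sub 1).mul (hL.hasDerivAt_line x e t)).add
      (hf.hasDerivAt_line x e t)).congr_deriv ?_
    simp only [hpL, id, mul_assoc, ← Finset.mul_sum]
    ring
  have hcont : Continuous fun t : ℝ =>
      (1 - t) * ∑ p, ∑ q, e p * e q * _root_.pd p (_root_.pd q f) (x + t • e) := by
    have : ∀ p q, Continuous (_root_.pd p (_root_.pd q f)) :=
      fun p q => ((hf.pd q).pd p).continuous
    fun_prop
  have h1 := intervalIntegral.integral_eq_sub_of_hasDerivAt (fun t _ => hder t)
    (hcont.intervalIntegrable 0 1)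
  rw [intervalIntegral.integral_of_le zero_le_one] at h1
  rw [setIntegral_congr_fun (g := fun t : ℝ =>
    (1 - t) * ∑ p, ∑ q, e p * e q * _root_.pd p (_root_.pd q f) (x + t • e)) measurableSet_Ioc,
    h1]
  · simp
    ring
  · intro t ht
    beta_reduce
    rw [abs_of_pos ht.1, max_eq_right (by linarith [ht.2])]

/-- A signed averaging kernel with unit mass and vanishing first moments: weights `a` and
displacements `e`, which are bounded by `ρ` where the weights do not vanish. -/
structure AvgKernel {Ω : Type*} [MeasurableSpace Ω] (ν : Measure Ω) (a : Ω → ℝ) (e : Ω → Dom3)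
    (A ρ : ℝ) : Prop where
  measurable_weight : Measurable a
  measurable_shift : Measurable e
  weight_le : ∀ ω, |a ω| ≤ A
  shift_le : ∀ ω, a ω ≠ 0 → ‖e ω‖ ≤ ρ
  mass : ∫ ω, a ω ∂ν = 1
  moment : ∀ i, ∫ ω, a ω * e ω i ∂ν = 0

/-- The second order remainder operators of an averaging kernel. -/
def remOp {Ω : Type*} [MeasurableSpace Ω] (ν : Measure Ω) (a : Ω → ℝ) (e : Ω → Dom3)
    (p q : Fin 3) (f : Dom3 → ℝ) : Dom3 → ℝ :=
  tavg (ν.prod (volume.restrict (Ioc (0 : ℝ) 1)))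
    (fun ω => a ω.1 * e ω.1 p * e ω.1 q * max 0 (1 - |ω.2|)) (fun ω => ω.2 • e ω.1) f

/-- The potential relating a stress field to its average. -/
def avgPotential {Ω : Type*} [MeasurableSpace Ω] (ν : Measure Ω) (a : Ω → ℝ) (e : Ω → Dom3)
    (u : Fin 3 → Fin 3 → Dom3 → ℝ) (i k j l : Fin 3) (x : Dom3) : ℝ :=
  remOp ν a e k l (u i j) x - remOp ν a e i l (u k j) x - remOp ν a e k j (u i l) x
    + remOp ν a e i j (u k l) x

theorem remOp_comm {Ω : Type*} [MeasurableSpace Ω] (ν : Measure Ω) (a : Ω → ℝ) (e : Ω → Dom3)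
    (p q : Fin 3) (f : Dom3 → ℝ) : remOp ν a e p q f = remOp ν a e q p f := by
  rw [remOp, remOp]
  congr 1
  funext ω
  ring

namespace AvgKernel

variable {Ω : Type*} [MeasurableSpace Ω] {ν : Measure Ω} {a : Ω → ℝ}
  {e : Ω → Dom3} {A ρ : ℝ} {f : Dom3 → ℝ} {u : Fin 3 → Fin 3 → Dom3 → ℝ}

theorem weight_nonneg (h : AvgKernel ν a e A ρ) : 0 ≤ A := by
  have : Nonempty Ω := by
    by_contra hne
    rw [not_nonempty_iff] at hne
    have := h.mass
    rw [Measure.eq_zero_of_isEmpty ν] at this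
    simp at this
  exact (abs_nonneg _).trans (h.weight_le (Classical.arbitrary Ω))

theorem abs_weight_mul_le (h : AvgKernel ν a e A ρ) (p : Fin 3) (ω : Ω) :
    |a ω * e ω p| ≤ A * ρ := by
  have hA := h.weight_nonneg
  by_cases h0 : a ω = 0
  · have hρ : 0 ≤ ρ := by
      by_contra hρ
      have : ∀ ω, a ω = 0 := fun ω => by
        by_contra h1
        exact hρ ((norm_nonneg _).trans (h.shift_le ω h1))
      have hm := h.mass
      simp [this] at hm
    simp only [h0, zero_mul, abs_zero]
    positivity
  · rw [abs_mul]
    exact mul_le_mul (h.weight_le ω) ((norm_le_pi_norm (e ω) p).trans (h.shift_le ω h0))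
      (abs_nonneg _) hA

theorem shift_bound_nonneg (h : AvgKernel ν a e A ρ) : 0 ≤ ρ := by
  by_contra hρ
  have : ∀ ω, a ω = 0 := fun ω => by
    by_contra h1
    exact hρ ((norm_nonneg _).trans (h.shift_le ω h1))
  have hm := h.mass
  simp [this] at hm

theorem abs_remWeight_le (h : AvgKernel ν a e A ρ) (p q : Fin 3) (ω : Ω × ℝ) :
    |a ω.1 * e ω.1 p * e ω.1 q * max 0 (1 - |ω.2|)| ≤ A * ρ * ρ := by
  have hA := h.weight_nonneg
  have hρ := h.shift_bound_nonneg
  by_cases h0 : a ω.1 = 0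
  · simp only [h0, zero_mul, abs_zero]
    positivity
  · rw [abs_mul, abs_mul]
    have h1 := h.abs_weight_mul_le p ω.1
    have h2 := (norm_le_pi_norm (e ω.1) q).trans (h.shift_le ω.1 h0)
    rw [Real.norm_eq_abs] at h2
    have h3 : |max 0 (1 - |ω.2|)| ≤ 1 := by
      rw [abs_of_nonneg (le_max_left _ _)]
      exact max_le zero_le_one (by linarith [abs_nonneg ω.2])
    calc _ ≤ (A * ρ) * ρ * 1 := by gcongr
      _ = _ := mul_one _

theorem measurable_remWeight (h : AvgKernel ν a e A ρ) (p q : Fin 3) :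
    Measurable fun ω : Ω × ℝ => a ω.1 * e ω.1 p * e ω.1 q * max 0 (1 - |ω.2|) := by
  have h1 := h.measurable_weight
  have h2 : ∀ p, Measurable fun ω => e ω p := fun p =>
    (measurable_pi_apply p).comp h.measurable_shift
  have h3 := h2 p
  have h4 := h2 q
  fun_prop

theorem measurable_remShift (h : AvgKernel ν a e A ρ) :
    Measurable fun ω : Ω × ℝ => ω.2 • e ω.1 := by
  have := h.measurable_shift
  fun_prop

variable [IsFiniteMeasure ν]

theorem smooth_tavg (h : AvgKernel ν a e A ρ) (hf : SmoothPeriodic f) :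
    SmoothPeriodic (tavg ν a e f) :=
  hf.tavg h.measurable_weight h.weight_le h.measurable_shift

theorem smooth_remOp (h : AvgKernel ν a e A ρ) (hf : SmoothPeriodic f) (p q : Fin 3) :
    SmoothPeriodic (remOp ν a e p q f) :=
  hf.tavg (h.measurable_remWeight p q) (h.abs_remWeight_le p q) h.measurable_remShift

theorem pd_remOp (h : AvgKernel ν a e A ρ) (hf : SmoothPeriodic f) (p q k : Fin 3) :
    pd k (remOp ν a e p q f) = remOp ν a e p q (pd k f) :=
  pd_tavg hf (h.measurable_remWeight p q) (h.abs_remWeight_le p q) h.measurable_remShift k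

theorem integrable_remOp (h : AvgKernel ν a e A ρ) (hf : SmoothPeriodic f) (p q : Fin 3)
    (x : Dom3) : Integrable (fun ω : Ω × ℝ => (a ω.1 * e ω.1 p * e ω.1 q * max 0 (1 - |ω.2|)) •
      f (x + ω.2 • e ω.1)) (ν.prod (volume.restrict (Ioc (0 : ℝ) 1))) :=
  integrable_tavg (h.measurable_remWeight p q) (h.abs_remWeight_le p q) h.measurable_remShift
    hf.2 hf.continuous x

theorem sum_remOp (h : AvgKernel ν a e A ρ) (hf : SmoothPeriodic f) (x : Dom3) :
    ∑ p, ∑ q, remOp ν a e p q (pd p (pd q f)) x = tavg ν a e f x - f x := by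
  have hi : ∀ p q, Integrable (fun ω : Ω × ℝ =>
      (a ω.1 * e ω.1 p * e ω.1 q * max 0 (1 - |ω.2|)) • pd p (pd q f) (x + ω.2 • e ω.1))
      (ν.prod (volume.restrict (Ioc (0 : ℝ) 1))) :=
    fun p q => h.integrable_remOp ((hf.pd q).pd p) p q x
  have hint := h.measurable_weight.aestronglyMeasurable (μ := ν)
  have ha : Integrable a ν := Integrable.of_bound hint A (Filter.Eventually.of_forall h.weight_le)
  have hae : ∀ p, Integrable (fun ω => a ω * e ω p) ν := fun p =>
    Integrable.of_bound (h.measurable_weight.mul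
      ((measurable_pi_apply p).comp h.measurable_shift)).aestronglyMeasurable (A * ρ)
      (Filter.Eventually.of_forall (h.abs_weight_mul_le p))
  simp only [remOp, tavg]
  simp_rw [← integral_finsetSum _ fun q _ => hi _ q]
  rw [← integral_finsetSum _ fun p _ => integrable_finsetSum _ fun q _ => hi p q,
    integral_prod _ (integrable_finsetSum _ fun p _ => integrable_finsetSum _ fun q _ => hi p q)]
  have h1 : ∀ ω, ∫ t in Ioc (0 : ℝ) 1, ∑ p, ∑ q, (a ω * e ω p * e ω q * max 0 (1 - |t|)) •
      pd p (pd q f) (x + t • e ω)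
      = a ω • f (x + e ω) - a ω * f x - ∑ p, a ω * e ω p * pd p f x := by
    intro ω
    have h2 := hf.taylor x (e ω)
    have h3 : ∀ t, ∑ p, ∑ q, (a ω * e ω p * e ω q * max 0 (1 - |t|)) • pd p (pd q f) (x + t • e ω)
        = a ω * (max 0 (1 - |t|) * ∑ p, ∑ q, e ω p * e ω q * pd p (pd q f) (x + t • e ω)) := by
      intro t
      simp only [Finset.mul_sum, smul_eq_mul]
      exact Finset.sum_congr rfl fun p _ => Finset.sum_congr rfl fun q _ => by ring
    simp_rw [h3]
    rw [integral_const_mul, h2, mul_sub, mul_sub, Finset.mul_sum, smul_eq_mul]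
    simp only [mul_assoc]
  have hs : ∀ p, Integrable (fun ω => a ω * e ω p * pd p f x) ν := fun p => (hae p).mul_const _
  simp only [h1]
  rw [integral_sub, integral_sub, integral_finsetSum _ fun p _ => hs p, integral_mul_const, h.mass]
  · simp [integral_mul_const, h.moment]
  · exact integrable_tavg h.measurable_weight h.weight_le h.measurable_shift hf.2 hf.continuous x
  · exact ha.mul_const _
  · exact (integrable_tavg h.measurable_weight h.weight_le h.measurable_shift hf.2
      hf.continuous x).sub (ha.mul_const _)
  · exact integrable_finsetSum _ fun p _ => hs p

theorem isPotential (h : AvgKernel ν a e A ρ) (hu : StressField u) :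
    IsPotential (avgPotential ν a e u) where
  smooth i k j l := (((h.smooth_remOp (hu.smooth i j) k l).sub
    (h.smooth_remOp (hu.smooth k j) i l)).sub (h.smooth_remOp (hu.smooth i l) k j)).add
    (h.smooth_remOp (hu.smooth k l) i j)
  anti i k j l := by
    funext x
    simp only [avgPotential]
    ring
  pair i k j l := by
    funext x
    simp only [avgPotential]
    rw [remOp_comm ν a e l k, remOp_comm ν a e j k, remOp_comm ν a e l i, remOp_comm ν a e j i,
      hu.symm j i, hu.symm l i, hu.symm j k, hu.symm l k]
    ring

theorem remOp_sum (h : AvgKernel ν a e A ρ) {f : Fin 3 → Dom3 → ℝ}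
    (hf : ∀ k, SmoothPeriodic (f k)) (p q : Fin 3) (x : Dom3) :
    ∑ k, remOp ν a e p q (f k) x = remOp ν a e p q (fun y => ∑ k, f k y) x := by
  simp only [remOp, tavg]
  rw [← integral_finsetSum _ fun k _ => h.integrable_remOp (hf k) p q x]
  simp only [Finset.smul_sum]

theorem ddiv_avgPotential (h : AvgKernel ν a e A ρ) (hu : StressField u) (i j : Fin 3)
    (x : Dom3) : ddiv (avgPotential ν a e u) i j x = tavg ν a e (u i j) x - u i j x := by
  have hz : ∀ p q, remOp ν a e p q (fun _ => 0) x = 0 := by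
    intro p q
    simp [remOp, tavg]
  have hdiv : ∀ i, (fun y => ∑ j, pd j (u i j) y) = fun _ => 0 := fun i => funext (hu.div i)
  have hpp : ∀ p q k l i j, pd k (pd l (remOp ν a e p q (u i j)))
      = remOp ν a e p q (pd k (pd l (u i j))) := by
    intro p q k l i j
    rw [h.pd_remOp (hu.smooth i j), h.pd_remOp ((hu.smooth i j).pd l)]
  have hterm : ∀ k l, pd k (pd l (avgPotential ν a e u i k j l)) x
      = remOp ν a e k l (pd k (pd l (u i j))) x - remOp ν a e i l (pd k (pd l (u k j))) x
        - remOp ν a e k j (pd k (pd l (u i l))) x + remOp ν a e i j (pd k (pd l (u k l))) x := by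
    intro k l
    have s1 := h.smooth_remOp (hu.smooth i j) k l
    have s2 := h.smooth_remOp (hu.smooth k j) i l
    have s3 := h.smooth_remOp (hu.smooth i l) k j
    have s4 := h.smooth_remOp (hu.smooth k l) i j
    have e1 : pd l (avgPotential ν a e u i k j l) = fun y => pd l (remOp ν a e k l (u i j)) y
        - pd l (remOp ν a e i l (u k j)) y - pd l (remOp ν a e k j (u i l)) y
        + pd l (remOp ν a e i j (u k l)) y := by
      funext y
      rw [← pd_sub s1 s2, ← pd_sub (s1.sub s2) s3, ← pd_add ((s1.sub s2).sub s3) s4]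
      rfl
    rw [e1, pd_add (((s1.pd l).sub (s2.pd l)).sub (s3.pd l)) (s4.pd l),
      pd_sub ((s1.pd l).sub (s2.pd l)) (s3.pd l), pd_sub (s1.pd l) (s2.pd l), hpp, hpp, hpp, hpp]
  have hdl : ∀ i k, (fun y => ∑ l, pd k (pd l (u i l)) y) = fun _ => 0 := by
    intro i k
    funext y
    rw [← pd_sum fun l _ => (hu.smooth i l).pd l, hdiv]
    simp [pd]
  have t2 : ∑ k, ∑ l, remOp ν a e i l (pd k (pd l (u k j))) x = 0 := by
    rw [Finset.sum_comm]
    refine Finset.sum_eq_zero fun l _ => ?_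
    have : ∀ k, pd k (pd l (u k j)) = pd l (pd k (u j k)) := by
      intro k
      rw [hu.symm k j, pd_comm (hu.smooth j k)]
    simp only [this]
    rw [h.remOp_sum fun k => ((hu.smooth j k).pd k).pd l, hdl, hz]
  have t3 : ∑ k, ∑ l, remOp ν a e k j (pd k (pd l (u i l))) x = 0 := by
    refine Finset.sum_eq_zero fun k _ => ?_
    rw [h.remOp_sum fun l => ((hu.smooth i l).pd l).pd k, hdl, hz]
  have t4 : ∑ k, ∑ l, remOp ν a e i j (pd k (pd l (u k l))) x = 0 := by
    refine Finset.sum_eq_zero fun k _ => ?_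
    rw [h.remOp_sum fun l => ((hu.smooth k l).pd l).pd k, hdl, hz]
  simp only [ddiv, hterm, Finset.sum_add_distrib, Finset.sum_sub_distrib]
  rw [t2, t3, t4, h.sum_remOp (hu.smooth i j)]
  ring

theorem stressField_tavg (h : AvgKernel ν a e A ρ) (hu : StressField u) :
    StressField fun i j => tavg ν a e (u i j) where
  smooth i j := h.smooth_tavg (hu.smooth i j)
  symm i j := by rw [hu.symm]
  div i x := by
    simp only [fun j => pd_tavg (ν := ν) (hu.smooth i j) h.measurable_weight h.weight_le
      h.measurable_shift j]
    simp only [tavg]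
    rw [← integral_finsetSum _ fun j _ => integrable_tavg h.measurable_weight h.weight_le
      h.measurable_shift ((hu.smooth i j).pd j).2 ((hu.smooth i j).pd j).continuous x]
    simp only [← Finset.smul_sum, hu.div, smul_zero, integral_zero]

end AvgKernel

theorem StressField.exists_potential {u : Fin 3 → Fin 3 → Dom3 → ℝ} (hu : StressField u)
    (hm : ∀ i j, ∫ x in unitBox, u i j x = 0) : ∃ R, IsPotential R ∧ ddiv R = u := by
  set c : Dom3 := fun i => ∫ y in unitBox, y i with hc
  have hone : ∀ y : Dom3, |(unitBox.indicator (fun _ => (1 : ℝ))) y| ≤ 1 := by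
    intro y
    by_cases hy : y ∈ unitBox <;> simp [hy]
  have hyi : ∀ i : Fin 3, Integrable (fun y : Dom3 => y i) (volume.restrict unitBox) := fun i =>
    Integrable.of_bound (measurable_pi_apply i).aestronglyMeasurable 1
      ((ae_restrict_iff' measurableSet_unitBox).2 (Filter.Eventually.of_forall fun y hy => by
        rw [Real.norm_eq_abs, abs_of_nonneg (hy i trivial).1]
        exact (hy i trivial).2.le))
  have key : ∀ g : Dom3 → ℝ, ∫ y in unitBox, unitBox.indicator (fun _ => (1 : ℝ)) y * g y
      = ∫ y in unitBox, g y := fun g =>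
    setIntegral_congr_fun measurableSet_unitBox fun y hy => by simp [indicator_of_mem hy]
  have h : AvgKernel (volume.restrict unitBox) (unitBox.indicator fun _ => (1 : ℝ))
      (fun y => y - c) 1 (1 + ‖c‖) :=
    { measurable_weight := measurable_const.indicator measurableSet_unitBox
      measurable_shift := measurable_id.sub_const c
      weight_le := hone
      shift_le := fun y hy => by
        have hy : y ∈ unitBox := by
          by_contra h0
          exact hy (indicator_of_notMem h0 _)
        refine (norm_sub_le _ _).trans (add_le_add_left ?_ _)
        refine (pi_norm_le_iff_of_nonneg zero_le_one).2 fun i => ?_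
        rw [Real.norm_eq_abs, abs_of_nonneg (hy i trivial).1]
        exact (hy i trivial).2.le
      mass := by
        simpa using key fun _ => 1
      moment := fun i => by
        rw [key]
        simp only [Pi.sub_apply]
        rw [integral_sub (hyi i) (integrable_const _)]
        simp [hc] }
  refine ⟨fun i k j l x => -1 * avgPotential (volume.restrict unitBox) _ _ u i k j l x,
    (h.isPotential hu).mul (SmoothPeriodic.const (-1)), ?_⟩
  funext i j x
  rw [(h.isPotential hu).ddiv_mul (SmoothPeriodic.const (-1)), h.ddiv_avgPotential hu]
  have hconst : ∀ k, pd k (fun _ => (-1 : ℝ)) = fun _ => 0 := by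
    intro k
    funext y
    simp [pd]
  have hconst0 : ∀ k, pd k (fun _ => (0 : ℝ)) = fun _ => 0 := by
    intro k
    funext y
    simp [pd]
  have h0 : tavg (volume.restrict unitBox) (unitBox.indicator fun _ => (1 : ℝ)) (fun y => y - c)
      (u i j) x = 0 := by
    simp only [tavg, smul_eq_mul]
    rw [key, ← hm i j, ← (hu.smooth i j).2.setIntegral_add (x - c)]
    congr 1
    funext y
    congr 1
    ring
  rw [h0]
  simp [hconst, hconst0]

/-! ### Smooth approximation of periodic functions -/

theorem exists_smoothPeriodic_integral_sub_le {g : Dom3 → ℝ} (hg : Measurable g)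
    (hper : PeriodicZ3 g) {C : ℝ} (hC : ∀ x, |g x| ≤ C) {ε : ℝ} (hε : 0 < ε) :
    ∃ χ, SmoothPeriodic χ ∧ ∫ x in unitBox, |χ x - g x| ≤ ε := by
  have hloc : LocallyIntegrable g volume :=
    (locallyIntegrable_const C).mono hg.aestronglyMeasurable
      (Filter.Eventually.of_forall fun x => (hC x).trans (le_abs_self C))
  have hC0 : 0 ≤ C := (abs_nonneg _).trans (hC 0)
  let φ : ℕ → ContDiffBump (0 : Dom3) := fun n =>
    { rIn := 1 / (n + 1) / 2
      rOut := 1 / (n + 1)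
      rIn_pos := by positivity
      rIn_lt_rOut := half_lt_self (by positivity) }
  have hout : Filter.Tendsto (fun n => (φ n).rOut) Filter.atTop (nhds 0) :=
    tendsto_one_div_add_atTop_nhds_zero_nat
  have hae := ContDiffBump.ae_convolution_tendsto_right_of_locallyIntegrable (μ := volume)
    (φ := φ) (K := 2) hout (Filter.Eventually.of_forall fun n => by
      change 1 / ((n : ℝ) + 1) ≤ 2 * (1 / (n + 1) / 2)
      linarith) hloc
  set χ : ℕ → Dom3 → ℝ := fun n => convolution ((φ n).normed volume) g
    (ContinuousLinearMap.lsmul ℝ ℝ) volume with hχ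
  have hform : ∀ n x, χ n x = ∫ t, (φ n).normed volume t * g (x - t) := fun n x => rfl
  have hsm : ∀ n, SmoothPeriodic (χ n) := fun n =>
    ⟨(φ n).hasCompactSupport_normed.contDiff_convolution_left _ (φ n).contDiff_normed hloc,
      fun x m => by
        simp only [hform]
        congr 1
        funext t
        rw [add_sub_right_comm, hper]⟩
  have hbd : ∀ n x, |χ n x| ≤ C := by
    intro n x
    rw [hform, ← Real.norm_eq_abs]
    refine (norm_integral_le_of_norm_le (g := fun t => (φ n).normed volume t * C)
      ((φ n).integrable_normed.mul_const C)
      (Filter.Eventually.of_forall fun t => ?_)).trans_eq ?_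
    · rw [norm_mul, Real.norm_of_nonneg ((φ n).nonneg_normed t)]
      exact mul_le_mul_of_nonneg_left (hC _) ((φ n).nonneg_normed t)
    · rw [integral_mul_const, (φ n).integral_normed, one_mul]
  have hlim : Filter.Tendsto (fun n => ∫ x in unitBox, |χ n x - g x|) Filter.atTop
      (nhds (∫ x in unitBox, 0)) := by
    refine tendsto_integral_of_dominated_convergence (fun _ => 2 * C)
      (fun n => ((hsm n).continuous.measurable.sub hg).abs.aestronglyMeasurable)
      (integrable_const _) (fun n => Filter.Eventually.of_forall fun x => ?_)
      (ae_restrict_of_ae ?_)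
    · rw [Real.norm_eq_abs, abs_abs]
      linarith [abs_sub (χ n x) (g x), hbd n x, hC x]
    · filter_upwards [hae] with x hx
      simpa using (hx.sub_const (g x)).abs
  rw [integral_zero] at hlim
  obtain ⟨n, hn⟩ := (hlim.eventually_le_const hε).exists
  exact ⟨χ n, hsm n, hn⟩

/-! ### Matrix fields with given components -/

theorem norm_matrixField_le {u : Fin 3 → Fin 3 → Dom3 → ℝ} {x : Dom3} {c : ℝ} (hc : 0 ≤ c)
    (h : ∀ i j, |u i j x| ≤ c) : ‖matrixField u x‖ ≤ 3 * c := by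
  rw [EuclideanSpace.norm_eq]
  refine Real.sqrt_le_iff.2 ⟨by positivity, ?_⟩
  calc ∑ p : Fin 3 × Fin 3, ‖matrixField u x p‖ ^ 2 ≤ ∑ _p : Fin 3 × Fin 3, c ^ 2 :=
        Finset.sum_le_sum fun p _ => pow_le_pow_left₀ (norm_nonneg _) (h p.1 p.2) 2
    _ = (3 * c) ^ 2 := by
        simp
        ring

theorem periodic_matrixField {u : Fin 3 → Fin 3 → Dom3 → ℝ}
    (hu : ∀ i j, SmoothPeriodic (u i j)) : PeriodicZ3 (matrixField u) := by
  intro x m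
  ext p
  exact (hu p.1 p.2).2 x m

theorem exists_uniform_bound {ι : Type*} [Finite ι] {g : ι → Dom3 → ℝ}
    (hg : ∀ i, SmoothPeriodic (g i)) : ∃ C, 0 ≤ C ∧ ∀ i x, |g i x| ≤ C := by
  choose C hC0 hC using fun i => (hg i).exists_bound
  cases nonempty_fintype ι
  exact ⟨∑ i, C i, Finset.sum_nonneg fun i _ => hC0 i, fun i x =>
    (hC i x).trans (Finset.single_le_sum (fun i _ => hC0 i) (Finset.mem_univ i))⟩

namespace IsPotential

variable {R : Fin 3 → Fin 3 → Fin 3 → Fin 3 → Dom3 → ℝ}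

/-- Localizing a rapidly oscillating double divergence. -/
theorem exists_ddiv_oscillating_bound (hR : IsPotential R) {χ : Dom3 → ℝ}
    (hχ : SmoothPeriodic χ) : ∃ C, 0 ≤ C ∧ ∀ n : ℕ, 0 < n → ∀ s i j x,
      |ddiv (fun i k j l x => χ x * (((n : ℝ) ^ 2)⁻¹ * R i k j l ((n : ℝ) • x + s))) i j x
        - χ x * ddiv R i j ((n : ℝ) • x + s)| ≤ C / n := by
  obtain ⟨A, hA0, hA⟩ := exists_uniform_bound (g := fun p : Fin 3 × Fin 3 => pd p.1 (pd p.2 χ))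
    fun p => (hχ.pd _).pd _
  obtain ⟨B, hB0, hB⟩ := exists_uniform_bound (g := fun p : Fin 3 => pd p χ) fun p => hχ.pd _
  obtain ⟨D, hD0, hD⟩ := exists_uniform_bound
    (g := fun p : Fin 3 × Fin 3 × Fin 3 × Fin 3 => R p.1 p.2.1 p.2.2.1 p.2.2.2)
    fun p => hR.smooth _ _ _ _
  obtain ⟨G, hG0, hG⟩ := exists_uniform_bound
    (g := fun p : Fin 3 × Fin 3 × Fin 3 × Fin 3 × Fin 3 =>
      pd p.1 (R p.2.1 p.2.2.1 p.2.2.2.1 p.2.2.2.2)) fun p => (hR.smooth _ _ _ _).pd _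
  refine ⟨9 * (A * D + 2 * (B * G)), by positivity, fun n hn s i j x => ?_⟩
  have hn1 : (1 : ℝ) ≤ n := by exact_mod_cast hn
  have hn0 : (n : ℝ) ≠ 0 := by positivity
  have hRn := hR.comp_smul_add n s
  have hS := hRn.mul (SmoothPeriodic.const ((n : ℝ) ^ 2)⁻¹)
  have h1 : ∀ i k j l m y, pd m (fun y => ((n : ℝ) ^ 2)⁻¹ * R i k j l ((n : ℝ) • y + s)) y
      = (n : ℝ)⁻¹ * pd m (R i k j l) ((n : ℝ) • y + s) := by
    intro i k j l m y
    rw [pd_const_mul (hRn.smooth i k j l), pd_comp_smul_add (hR.smooth i k j l)]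
    field_simp
  have h2 : ddiv (fun i k j l y => ((n : ℝ) ^ 2)⁻¹ * R i k j l ((n : ℝ) • y + s)) i j x
      = ddiv R i j ((n : ℝ) • x + s) := by
    simp only [ddiv]
    refine Finset.sum_congr rfl fun k _ => Finset.sum_congr rfl fun l _ => ?_
    have hl := (hR.smooth i k j l).pd l
    rw [show pd l (fun y => ((n : ℝ) ^ 2)⁻¹ * R i k j l ((n : ℝ) • y + s))
      = fun y => (n : ℝ)⁻¹ * pd l (R i k j l) ((n : ℝ) • y + s) from funext fun y => h1 i k j l l y,
      pd_const_mul (hl.comp_smul_add n s), pd_comp_smul_add hl]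
    field_simp
  rw [hS.ddiv_mul hχ, h2, add_sub_cancel_left]
  refine (Finset.abs_sum_le_sum_abs _ _).trans ?_
  have hterm : ∀ k l, |pd k (pd l χ) x * (((n : ℝ) ^ 2)⁻¹ * R i k j l ((n : ℝ) • x + s))
      + pd l χ x * pd k (fun y => ((n : ℝ) ^ 2)⁻¹ * R i k j l ((n : ℝ) • y + s)) x
      + pd k χ x * pd l (fun y => ((n : ℝ) ^ 2)⁻¹ * R i k j l ((n : ℝ) • y + s)) x|
      ≤ (A * D + 2 * (B * G)) * (n : ℝ)⁻¹ := by
    intro k l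
    rw [h1, h1]
    have hninv : ((n : ℝ) ^ 2)⁻¹ ≤ (n : ℝ)⁻¹ := by
      apply inv_anti₀ (by positivity)
      nlinarith
    have t1 : |pd k (pd l χ) x * (((n : ℝ) ^ 2)⁻¹ * R i k j l ((n : ℝ) • x + s))|
        ≤ A * ((n : ℝ)⁻¹ * D) := by
      rw [abs_mul, abs_mul, abs_of_nonneg (by positivity : 0 ≤ ((n : ℝ) ^ 2)⁻¹)]
      exact mul_le_mul (hA (k, l) x) (mul_le_mul hninv (hD (i, k, j, l) _) (abs_nonneg _)
        (by positivity)) (by positivity) hA0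
    have t2 : ∀ k l, |pd l χ x * ((n : ℝ)⁻¹ * pd k (R i k j l) ((n : ℝ) • x + s))|
        ≤ B * ((n : ℝ)⁻¹ * G) := by
      intro k l
      rw [abs_mul, abs_mul, abs_of_nonneg (by positivity : 0 ≤ (n : ℝ)⁻¹)]
      exact mul_le_mul (hB l x) (mul_le_mul_of_nonneg_left (hG (k, i, k, j, l) _)
        (by positivity)) (by positivity) hB0
    have t3 : |pd k χ x * ((n : ℝ)⁻¹ * pd l (R i k j l) ((n : ℝ) • x + s))|
        ≤ B * ((n : ℝ)⁻¹ * G) := by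
      rw [abs_mul, abs_mul, abs_of_nonneg (by positivity : 0 ≤ (n : ℝ)⁻¹)]
      exact mul_le_mul (hB k x) (mul_le_mul_of_nonneg_left (hG (l, i, k, j, l) _)
        (by positivity)) (by positivity) hB0
    refine (abs_add_le _ _).trans ?_
    have := abs_add_le (pd k (pd l χ) x * (((n : ℝ) ^ 2)⁻¹ * R i k j l ((n : ℝ) • x + s)))
      (pd l χ x * ((n : ℝ)⁻¹ * pd k (R i k j l) ((n : ℝ) • x + s)))
    linarith [t2 k l]
  calc _ ≤ ∑ _k : Fin 3, ∑ _l : Fin 3, (A * D + 2 * (B * G)) * (n : ℝ)⁻¹ :=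
        Finset.sum_le_sum fun k _ => (Finset.abs_sum_le_sum_abs _ _).trans
          (Finset.sum_le_sum fun l _ => hterm k l)
    _ = 9 * (A * D + 2 * (B * G)) / n := by
        simp
        ring

end IsPotential

/-! ### The envelope of a Lipschitz function -/

theorem zero_mem_testClass : (fun _ => 0 : Dom3 → M33) ∈ TestClass :=
  ⟨contDiff_const, fun _ _ => rfl, fun _ _ _ => rfl, fun x i => by simp, by simp⟩

theorem integrable_comp_add {f : M33 → ℝ} (hf : Continuous f) (ξ : M33) {φ : Dom3 → M33}
    (hφ : φ ∈ TestClass) : Integrable (fun x => f (ξ + φ x)) (volume.restrict unitBox) :=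
  integrable_unitBox (fun x m => by simp only [hφ.2.1 x m])
    (hf.comp (continuous_const.add hφ.1.continuous))

section envelope

variable {f : M33 → ℝ}

theorem bddBelow_envelope (h0 : ∀ η, 0 ≤ f η) (ξ : M33) :
    BddBelow ((fun φ : Dom3 → M33 => ∫ x in unitBox, f (ξ + φ x)) '' TestClass) :=
  ⟨0, by rintro _ ⟨φ, -, rfl⟩; exact integral_nonneg fun x => h0 _⟩

theorem envelope_le (h0 : ∀ η, 0 ≤ f η) (ξ : M33) {φ : Dom3 → M33} (hφ : φ ∈ TestClass) :
    sdqcEnvelope f ξ ≤ ∫ x in unitBox, f (ξ + φ x) :=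
  csInf_le (bddBelow_envelope h0 ξ) ⟨φ, hφ, rfl⟩

theorem envelope_nonneg (h0 : ∀ η, 0 ≤ f η) (ξ : M33) : 0 ≤ sdqcEnvelope f ξ :=
  Real.sInf_nonneg (by rintro _ ⟨φ, -, rfl⟩; exact integral_nonneg fun x => h0 _)

theorem envelope_le_self (h0 : ∀ η, 0 ≤ f η) (ξ : M33) : sdqcEnvelope f ξ ≤ f ξ := by
  simpa using envelope_le h0 ξ zero_mem_testClass

theorem exists_lt_envelope_add (f : M33 → ℝ) (ξ : M33) {ε : ℝ} (hε : 0 < ε) :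
    ∃ φ ∈ TestClass, ∫ x in unitBox, f (ξ + φ x) < sdqcEnvelope f ξ + ε := by
  obtain ⟨_, ⟨φ, hφ, rfl⟩, h⟩ := exists_lt_of_csInf_lt
    (s := (fun φ : Dom3 → M33 => ∫ x in unitBox, f (ξ + φ x)) '' TestClass)
    ⟨_, _, zero_mem_testClass, rfl⟩ (lt_add_of_pos_right (sdqcEnvelope f ξ) hε)
  exact ⟨φ, hφ, h⟩

theorem LipschitzWith.le_add_norm (hf : LipschitzWith 1 f) (ξ η : M33) :
    f ξ ≤ f η + ‖ξ - η‖ := by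
  have := hf.dist_le_mul ξ η
  rw [Real.dist_eq, NNReal.coe_one, one_mul, dist_eq_norm] at this
  linarith [le_abs_self (f ξ - f η)]

theorem envelope_le_add_norm (hf : LipschitzWith 1 f) (h0 : ∀ η, 0 ≤ f η) (ξ η : M33) :
    sdqcEnvelope f ξ ≤ sdqcEnvelope f η + ‖ξ - η‖ := by
  refine le_of_forall_pos_le_add fun ε hε => ?_
  obtain ⟨φ, hφ, h⟩ := exists_lt_envelope_add f η hε
  have h1 : ∫ x in unitBox, f (ξ + φ x) ≤ ∫ x in unitBox, (f (η + φ x) + ‖ξ - η‖) := by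
    refine integral_mono (integrable_comp_add hf.continuous ξ hφ)
      ((integrable_comp_add hf.continuous η hφ).add (integrable_const _)) fun x => ?_
    simpa using hf.le_add_norm (ξ + φ x) (η + φ x)
  rw [integral_add (integrable_comp_add hf.continuous η hφ) (integrable_const _)] at h1
  simp only [integral_const, probReal_univ, smul_eq_mul, one_mul] at h1
  linarith [envelope_le h0 ξ hφ]

theorem lipschitzWith_envelope (hf : LipschitzWith 1 f) (h0 : ∀ η, 0 ≤ f η) :
    LipschitzWith 1 (sdqcEnvelope f) := by
  refine LipschitzWith.of_dist_le_mul fun ξ η => ?_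
  rw [Real.dist_eq, NNReal.coe_one, one_mul, dist_eq_norm, abs_le]
  have h1 := envelope_le_add_norm hf h0 ξ η
  have h2 := envelope_le_add_norm hf h0 η ξ
  rw [norm_sub_rev] at h2
  constructor <;> linarith

/-- Two-scale test functions are admissible for the envelope. -/
theorem envelope_le_integral_integral (hf : LipschitzWith 1 f) (h0 : ∀ η, 0 ≤ f η) (ξ : M33)
    {ψ : Dom3 → M33} (hψ : ψ ∈ TestClass) {ι : Type*} [Fintype ι] {χ : ι → Dom3 → ℝ}
    (hχ : ∀ a, SmoothPeriodic (χ a)) {R : ι → Fin 3 → Fin 3 → Fin 3 → Fin 3 → Dom3 → ℝ}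
    (hR : ∀ a, IsPotential (R a)) :
    sdqcEnvelope f ξ ≤ ∫ x in unitBox, ∫ s in unitBox,
      f (ξ + ψ x + ∑ a, χ a x • matrixField (ddiv (R a)) s) := by
  choose C hC0 hC using fun a => (hR a).exists_ddiv_oscillating_bound (hχ a)
  set D := ∑ a, C a with hD
  have hD0 : 0 ≤ D := Finset.sum_nonneg fun a _ => hC0 a
  have hcφ : ∀ a, Continuous (matrixField (ddiv (R a))) := fun a =>
    (contDiff_matrixField (hR a).smooth_ddiv).continuous
  have hpφ : ∀ a, PeriodicZ3 (matrixField (ddiv (R a))) := fun a =>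
    periodic_matrixField (hR a).smooth_ddiv
  set F : Dom3 → Dom3 → ℝ := fun x s => f (ξ + ψ x + ∑ a, χ a x • matrixField (ddiv (R a)) s)
    with hF
  have hFc : Continuous (Function.uncurry F) := by
    have h1 := hf.continuous
    have h2 := hψ.1.continuous
    have h3 := fun a => (hχ a).continuous
    simp only [hF, Function.uncurry_def]
    fun_prop
  have hFps : ∀ x, PeriodicZ3 (F x) := fun x s m => by simp only [hF, fun a => hpφ a s m]
  have hFpx : ∀ x s (m : Fin 3 → ℤ), F (x + fun i => (m i : ℝ)) s = F x s := fun x s m => by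
    simp only [hF, fun a => (hχ a).2 x m, hψ.2.1 x m]
  obtain ⟨M, hM⟩ : ∃ M, ∀ x s, |F x s| ≤ M := by
    obtain ⟨M, hM⟩ := ((isCompact_Icc (a := (0 : Dom3)) (b := 1)).prod
      (isCompact_Icc (a := (0 : Dom3)) (b := 1))).exists_bound_of_continuousOn hFc.continuousOn
    refine ⟨M, fun x s => ?_⟩
    have h1 := hFpx (x - fun i => (⌊x i⌋ : ℝ)) s fun i => ⌊x i⌋
    rw [sub_add_cancel] at h1
    rw [h1, ← (hFps _).sub_floor s]
    exact hM (_, _) ⟨unitBox_subset_Icc (sub_floor_mem_unitBox x),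
      unitBox_subset_Icc (sub_floor_mem_unitBox s)⟩
  have hint : ∀ g : Dom3 × Dom3 → Dom3 × Dom3, Continuous g → Integrable
      (fun p => Function.uncurry F (g p))
      ((volume.restrict unitBox).prod (volume.restrict unitBox)) := fun g hg =>
    Integrable.of_bound (hFc.comp hg).aestronglyMeasurable M
      (Filter.Eventually.of_forall fun p => hM _ _)
  have key : ∀ n : ℕ, 0 < n → ∀ s,
      sdqcEnvelope f ξ ≤ (∫ x in unitBox, F x ((n : ℝ) • x + s)) + 3 * (D / n) := by
    intro n hn s
    have hRn : ∀ a ∈ Finset.univ, IsPotential fun i k j l x =>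
        χ a x * (((n : ℝ) ^ 2)⁻¹ * R a i k j l ((n : ℝ) • x + s)) := fun a _ =>
      (((hR a).comp_smul_add n s).mul (SmoothPeriodic.const ((n : ℝ) ^ 2)⁻¹)).mul (hχ a)
    have hS := IsPotential.sum hRn
    have hmem := add_ddiv_mem_testClass hψ hS
    refine (envelope_le h0 ξ hmem).trans ?_
    have hI : Integrable (fun x => F x ((n : ℝ) • x + s)) (volume.restrict unitBox) :=
      Integrable.of_bound (hFc.comp (g := Function.uncurry F)
        (f := fun x : Dom3 => (x, (n : ℝ) • x + s)) (by fun_prop)).aestronglyMeasurable M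
        (Filter.Eventually.of_forall fun x => hM _ _)
    calc _ ≤ ∫ x in unitBox, (F x ((n : ℝ) • x + s) + 3 * (D / n)) := by
          refine integral_mono (integrable_comp_add hf.continuous ξ hmem)
            (hI.add (integrable_const _)) fun x => ?_
          refine (hf.le_add_norm _ (ξ + ψ x + ∑ a, χ a x • matrixField (ddiv (R a))
            ((n : ℝ) • x + s))).trans (add_le_add_right ?_ _)
          rw [← add_assoc, add_sub_add_left_eq_sub]
          have hdiff : matrixField (ddiv fun i k j l x =>
              ∑ a, χ a x * (((n : ℝ) ^ 2)⁻¹ * R a i k j l ((n : ℝ) • x + s))) x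
              - ∑ a, χ a x • matrixField (ddiv (R a)) ((n : ℝ) • x + s)
              = matrixField (fun i j x => ∑ a, (ddiv (fun i k j l x => χ a x *
                (((n : ℝ) ^ 2)⁻¹ * R a i k j l ((n : ℝ) • x + s))) i j x
                - χ a x * ddiv (R a) i j ((n : ℝ) • x + s))) x := by
            ext p
            simp [matrixField, IsPotential.ddiv_sum hRn]
          rw [hdiff]
          refine norm_matrixField_le (by positivity) fun i j => ?_
          refine (Finset.abs_sum_le_sum_abs _ _).trans ?_
          rw [hD, Finset.sum_div]
          exact Finset.sum_le_sum fun a _ => hC a n hn s i j x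
      _ = _ := by
          rw [integral_add hI (integrable_const _)]
          simp
  have key2 : ∀ n : ℕ, 0 < n →
      sdqcEnvelope f ξ ≤ (∫ x in unitBox, ∫ s in unitBox, F x s) + 3 * (D / n) := by
    intro n hn
    have hI1 := hint (fun p => (p.1, (n : ℝ) • p.1 + p.2)) (by fun_prop)
    have e1 : ∫ s in unitBox, ∫ x in unitBox, F x ((n : ℝ) • x + s)
        = ∫ x in unitBox, ∫ s in unitBox, F x s := by
      rw [← integral_integral_swap hI1]
      congr 1
      funext x
      exact (hFps x).setIntegral_add _
    rw [← e1]
    have hI2 : Integrable (fun s => ∫ x in unitBox, F x ((n : ℝ) • x + s))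
        (volume.restrict unitBox) := hI1.integral_prod_right
    calc sdqcEnvelope f ξ = ∫ _s in unitBox, sdqcEnvelope f ξ := by simp
      _ ≤ ∫ s in unitBox, ((∫ x in unitBox, F x ((n : ℝ) • x + s)) + 3 * (D / n)) :=
          integral_mono (integrable_const _) (hI2.add (integrable_const _)) fun s => key n hn s
      _ = _ := by
          rw [integral_add hI2 (integrable_const _)]
          simp
  have hlim : Filter.Tendsto
      (fun n : ℕ => (∫ x in unitBox, ∫ s in unitBox, F x s) + 3 * (D / n)) Filter.atTop
      (nhds ((∫ x in unitBox, ∫ s in unitBox, F x s) + 3 * 0)) :=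
    ((tendsto_const_div_atTop_nhds_zero_nat D).const_mul 3).const_add _
  rw [mul_zero, add_zero] at hlim
  exact ge_of_tendsto hlim (Filter.eventually_atTop.2 ⟨1, fun n hn => key2 n hn⟩)

end envelope

theorem symDivQC_envelope {f : M33 → ℝ} (hf : LipschitzWith 1 f) (h0 : ∀ η, 0 ≤ f η) :
    SymDivQC (sdqcEnvelope f) := by
  intro ξ _ ψ hψ
  have hQ := lipschitzWith_envelope hf h0
  refine le_of_forall_pos_le_add fun ε' hε' => ?_
  obtain ⟨ε, hε, rfl⟩ : ∃ ε > 0, ε' = 4 * ε := ⟨ε' / 4, by positivity, by ring⟩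
  have hψc := hψ.1.continuous
  obtain ⟨t, -, htf, ht⟩ :=
    ((isCompact_Icc (a := (0 : Dom3)) (b := 1)).image hψc).finite_cover_balls hε
  obtain ⟨n, c, -, hc⟩ := htf.fin_param
  have hcov : ∀ x, ∃ a, ‖ψ x - c a‖ < ε := by
    intro x
    have h1 := ht (mem_image_of_mem ψ (unitBox_subset_Icc (sub_floor_mem_unitBox x)))
    rw [PeriodicZ3.sub_floor hψ.2.1 x] at h1
    simp only [mem_iUnion, ← hc] at h1
    obtain ⟨_, ⟨a, rfl⟩, ha⟩ := h1
    exact ⟨a, by rwa [Metric.mem_ball, dist_eq_norm] at ha⟩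
  set A : Fin n → Set Dom3 := fun a => {x | ‖ψ x - c a‖ < ε ∧ ∀ b < a, ε ≤ ‖ψ x - c b‖} with hA
  have hAm : ∀ a, MeasurableSet (A a) := by
    intro a
    have hn : ∀ b, Continuous fun x => ‖ψ x - c b‖ := fun b => (hψc.sub continuous_const).norm
    have : A a = {x | ‖ψ x - c a‖ < ε} ∩ ⋂ b, ⋂ (_ : b < a), {x | ε ≤ ‖ψ x - c b‖} := by
      ext x
      simp [hA]
    rw [this]
    exact (isOpen_lt (hn a) continuous_const).measurableSet.inter
      (MeasurableSet.iInter fun b => MeasurableSet.iInter fun _ =>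
        (isClosed_le continuous_const (hn b)).measurableSet)
  have hAex : ∀ x, ∃ a, x ∈ A a := by
    intro x
    obtain ⟨a, ha, hmin⟩ := WellFounded.has_min wellFounded_lt {a | ‖ψ x - c a‖ < ε} (hcov x)
    exact ⟨a, ha, fun b hb => not_lt.1 fun h => hmin b h hb⟩
  have hAuniq : ∀ x a b, x ∈ A a → x ∈ A b → a = b := by
    intro x a b ha hb
    rcases lt_trichotomy a b with h | h | h
    · exact absurd ha.1 (not_lt.2 (hb.2 a h))
    · exact h
    · exact absurd hb.1 (not_lt.2 (ha.2 b h))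
  set g : Fin n → Dom3 → ℝ := fun a => (A a).indicator fun _ => 1 with hg
  have hgper : ∀ a, PeriodicZ3 (g a) := by
    intro a x m
    have : (x + fun i => (m i : ℝ)) ∈ A a ↔ x ∈ A a := by simp only [hA, mem_ofPred_eq, hψ.2.1 x m]
    by_cases hx : x ∈ A a <;> simp [hg, this, hx]
  have hgm : ∀ a, Measurable (g a) := fun a => measurable_const.indicator (hAm a)
  have hg1 : ∀ a x, |g a x| ≤ 1 := by
    intro a x
    by_cases hx : x ∈ A a <;> simp [hg, hx]
  choose φ hφ hφlt using fun a => exists_lt_envelope_add f (ξ + c a) hε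
  choose u hu hum hφu using fun a => mem_testClass_iff.1 (hφ a)
  choose R hR hRu using fun a => (hu a).exists_potential (hum a)
  choose B hB0 hB using fun a => PeriodicZ3.exists_bound (hφ a).2.1 (hφ a).1.continuous
  set D := ∑ a, B a with hD
  have hD0 : 0 ≤ D := Finset.sum_nonneg fun a _ => hB0 a
  have hBD : ∀ a s, ‖φ a s‖ ≤ D := fun a s =>
    (hB a s).trans (Finset.single_le_sum (fun a _ => hB0 a) (Finset.mem_univ a))
  choose χ hχ hχg using fun a => exists_smoothPeriodic_integral_sub_le (hgm a) (hgper a) (hg1 a)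
    (show 0 < ε / ((n + 1) * (D + 1)) by positivity)
  refine (envelope_le_integral_integral hf h0 ξ hψ hχ hR).trans ?_
  have hφR : ∀ a, matrixField (ddiv (R a)) = φ a := fun a => by rw [hRu, hφu]
  simp only [hφR]
  have hpt : ∀ x, ∫ s in unitBox, f (ξ + ψ x + ∑ a, χ a x • φ a s)
      ≤ sdqcEnvelope f (ξ + ψ x) + (3 * ε + D * ∑ a, |χ a x - g a x|) := by
    intro x
    obtain ⟨a, ha⟩ := hAex x
    have hgsum : ∀ s, φ a s = ∑ b, g b x • φ b s := by
      intro s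
      rw [Finset.sum_eq_single a]
      · simp [hg, ha]
      · intro b _ hb
        have : x ∉ A b := fun h => hb (hAuniq x b a h ha)
        simp [hg, this]
      · simp
    have hφint := integrable_comp_add hf.continuous (ξ + c a) (hφ a)
    have h1 : ∫ s in unitBox, f (ξ + ψ x + ∑ a, χ a x • φ a s)
        ≤ ∫ s in unitBox, (f (ξ + c a + φ a s) + (ε + D * ∑ b, |χ b x - g b x|)) := by
      refine integral_mono_of_nonneg (Filter.Eventually.of_forall fun s => h0 _)
        (hφint.add (integrable_const _)) (Filter.Eventually.of_forall fun s => ?_)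
      refine (hf.le_add_norm _ (ξ + c a + φ a s)).trans (add_le_add_right ?_ _)
      have e1 : ξ + ψ x + ∑ b, χ b x • φ b s - (ξ + c a + φ a s)
          = (ψ x - c a) + ∑ b, (χ b x - g b x) • φ b s := by
        rw [hgsum s]
        simp only [sub_smul, Finset.sum_sub_distrib]
        abel
      rw [e1, Finset.mul_sum]
      refine (norm_add_le _ _).trans (add_le_add ha.1.le ((norm_sum_le _ _).trans ?_))
      refine Finset.sum_le_sum fun b _ => ?_
      rw [norm_smul, mul_comm, Real.norm_eq_abs]
      exact mul_le_mul_of_nonneg_right (hBD b s) (abs_nonneg _)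
    rw [integral_add hφint (integrable_const _)] at h1
    simp only [integral_const, probReal_univ, smul_eq_mul, one_mul] at h1
    have h2 := hQ.le_add_norm (ξ + c a) (ξ + ψ x)
    rw [add_sub_add_left_eq_sub, norm_sub_rev] at h2
    linarith [hφlt a, ha.1]
  have hi1 := integrable_comp_add hQ.continuous ξ hψ
  have hi2 : ∀ a, Integrable (fun x => |χ a x - g a x|) (volume.restrict unitBox) := by
    intro a
    obtain ⟨C, -, hC⟩ := (hχ a).exists_bound
    refine Integrable.of_bound ((hχ a).continuous.measurable.sub (hgm a)).abs.aestronglyMeasurable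
      (C + 1) (Filter.Eventually.of_forall fun x => ?_)
    rw [Real.norm_eq_abs, abs_abs]
    linarith [abs_sub (χ a x) (g a x), hC x, hg1 a x]
  have hi3 : Integrable (fun x => 3 * ε + D * ∑ a, |χ a x - g a x|) (volume.restrict unitBox) :=
    (integrable_const _).add ((integrable_finsetSum _ fun a _ => hi2 a).const_mul D)
  calc _ ≤ ∫ x in unitBox, (sdqcEnvelope f (ξ + ψ x) + (3 * ε + D * ∑ a, |χ a x - g a x|)) :=
        integral_mono_of_nonneg (Filter.Eventually.of_forall fun x => integral_nonneg fun s => h0 _)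
          (hi1.add hi3) (Filter.Eventually.of_forall hpt)
    _ = (∫ x in unitBox, sdqcEnvelope f (ξ + ψ x))
        + (3 * ε + D * ∑ a, ∫ x in unitBox, |χ a x - g a x|) := by
        rw [integral_add hi1 hi3, integral_add (integrable_const _)
          ((integrable_finsetSum _ fun a _ => hi2 a).const_mul D), integral_const_mul D,
          integral_finsetSum _ fun a _ => hi2 a]
        simp
    _ ≤ (∫ x in unitBox, sdqcEnvelope f (ξ + ψ x))
        + (3 * ε + D * ∑ _a : Fin n, ε / ((n + 1) * (D + 1))) := by
        gcongr with a
        exact hχg a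
    _ ≤ _ := by
        have : D * ∑ _a : Fin n, ε / ((n + 1) * (D + 1)) ≤ ε := by
          simp only [Finset.sum_const, Finset.card_univ, Fintype.card_fin, nsmul_eq_mul]
          rw [show D * (n * (ε / ((n + 1) * (D + 1)))) = ε * ((n / (n + 1)) * (D / (D + 1))) by
            field_simp]
          refine mul_le_of_le_one_right hε.le (mul_le_one₀ ?_ (by positivity) ?_)
          · exact (div_le_one (by positivity)).2 (by linarith)
          · exact (div_le_one (by positivity)).2 (by linarith)
        linarith

/-- The envelope of the distance function is itself a competitor. -/
theorem hullInf_subset_hullP_one {K : Set M33} (hne : K.Nonempty) :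
    hullInf K ⊆ hullP K 1 := by
  rintro ξ ⟨hξ, h⟩
  have hf : LipschitzWith 1 fun η => Metric.infDist η K := Metric.lipschitz_infDist_pt K
  have h0 : ∀ η, 0 ≤ Metric.infDist η K := fun η => Metric.infDist_nonneg
  refine ⟨hξ, ?_⟩
  simp only [Real.rpow_one]
  have h1 := h _ (lipschitzWith_envelope hf h0).continuous (envelope_nonneg h0)
    (symDivQC_envelope hf h0)
  have h2 : sdqcEnvelope (fun η => Metric.infDist η K) '' K ⊆ {0} := by
    rintro _ ⟨η, hη, rfl⟩
    refine le_antisymm ((envelope_le_self h0 η).trans_eq (Metric.infDist_zero_of_mem hη))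
      (envelope_nonneg h0 η)
  have h3 : sSup (sdqcEnvelope (fun η => Metric.infDist η K) '' K) ≤ 0 :=
    csSup_le (hne.image _) fun y hy => (h2 hy).le
  exact le_antisymm (h1.trans h3) (envelope_nonneg h0 ξ)

/-! ### Mollification -/

/-- Smooth functions supported in the ball of radius `1/4`. -/
structure IsMollifier (w : Dom3 → ℝ) : Prop where
  smooth : ContDiff ℝ (⊤ : ℕ∞) w
  eq_zero : ∀ y, 1 / 4 < ‖y‖ → w y = 0

/-- The average of `f` at scale `s` with weight `w`. -/
def mollify (w : Dom3 → ℝ) (s : ℝ) (f : Dom3 → ℝ) : Dom3 → ℝ :=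
  tavg (volume.restrict (Metric.closedBall 0 1)) w (fun y => s • y) f

namespace IsMollifier

variable {w f : Dom3 → ℝ} {s C : ℝ}

theorem pd (hw : IsMollifier w) (j : Fin 3) : IsMollifier (pd j w) where
  smooth := (contDiff_infty_iff_fderiv.1 hw.smooth).2.clm_apply contDiff_const
  eq_zero y hy := by
    have h1 : w =ᶠ[nhds y] fun _ => 0 := by
      filter_upwards [(isOpen_lt continuous_const continuous_norm).mem_nhds hy] with z hz
      exact hw.eq_zero z hz
    rw [_root_.pd, h1.fderiv_eq]
    simp

theorem hasCompactSupport (hw : IsMollifier w) : HasCompactSupport w :=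
  HasCompactSupport.intro (isCompact_closedBall 0 (1 / 4)) fun y hy => hw.eq_zero y (by
    rwa [Metric.mem_closedBall, dist_zero_right, not_le] at hy)

theorem exists_bound (hw : IsMollifier w) : ∃ B, 0 ≤ B ∧ ∀ y, |w y| ≤ B := by
  obtain ⟨B, hB⟩ := hw.hasCompactSupport.exists_bound_of_continuous hw.smooth.continuous
  exact ⟨B, (norm_nonneg _).trans (hB 0), hB⟩

theorem mollify_eq (hw : IsMollifier w) (s : ℝ) (f : Dom3 → ℝ) (x : Dom3) :
    mollify w s f x = ∫ y, w y * f (x + s • y) := by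
  refine setIntegral_eq_integral_of_forall_compl_eq_zero fun y hy => ?_
  rw [Metric.mem_closedBall, dist_zero_right, not_le] at hy
  rw [hw.eq_zero y (by linarith), zero_smul]

theorem mollify_eq_convolution (hw : IsMollifier w) (hs : 0 < s) (f : Dom3 → ℝ) (x : Dom3) :
    mollify w s f x = convolution (fun z => f (s • z)) (fun z => w (-z))
      (ContinuousLinearMap.lsmul ℝ ℝ) volume (s⁻¹ • x) := by
  rw [hw.mollify_eq, ← integral_sub_right_eq_self _ (s⁻¹ • x), convolution]
  congr 1
  funext t
  simp only [ContinuousLinearMap.lsmul_apply, smul_eq_mul, neg_sub, smul_sub]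
  rw [smul_inv_smul₀ hs.ne', add_sub_cancel, mul_comm]

theorem locallyIntegrable_scaled (hf : Measurable f) (hC : ∀ x, |f x| ≤ C) (s : ℝ) :
    LocallyIntegrable (fun z : Dom3 => f (s • z)) volume :=
  (locallyIntegrable_const C).mono (hf.comp (measurable_const_smul s)).aestronglyMeasurable
    (Filter.Eventually.of_forall fun _ => (hC _).trans (le_abs_self C))

theorem contDiff_mollify (hw : IsMollifier w) (hs : 0 < s) (hf : Measurable f)
    (hC : ∀ x, |f x| ≤ C) : ContDiff ℝ (⊤ : ℕ∞) (mollify w s f) := by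
  rw [funext (hw.mollify_eq_convolution hs f)]
  have hcs : HasCompactSupport fun z => w (-z) :=
    hw.hasCompactSupport.comp_homeomorph (Homeomorph.neg Dom3)
  exact (hcs.contDiff_convolution_right _ (locallyIntegrable_scaled hf hC s)
    (hw.smooth.comp contDiff_neg)).comp (contDiff_const_smul s⁻¹)

theorem pd_mollify (hw : IsMollifier w) (hs : 0 < s) (hf : Measurable f)
    (hC : ∀ x, |f x| ≤ C) (j : Fin 3) (x : Dom3) :
    _root_.pd j (mollify w s f) x = -s⁻¹ * mollify (_root_.pd j w) s f x := by
  have hcs : HasCompactSupport fun z => w (-z) :=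
    hw.hasCompactSupport.comp_homeomorph (Homeomorph.neg Dom3)
  have hsm : ContDiff ℝ (⊤ : ℕ∞) fun z => w (-z) := hw.smooth.comp contDiff_neg
  have hli := locallyIntegrable_scaled hf hC s
  have hsm1 : ContDiff ℝ 1 fun z => w (-z) := hsm.of_le (by exact_mod_cast le_top)
  have h1 := hcs.hasFDerivAt_convolution_right (ContinuousLinearMap.lsmul ℝ ℝ) hli hsm1 (s⁻¹ • x)
  have h2 := h1.comp x ((hasFDerivAt_id x).const_smul s⁻¹)
  rw [_root_.pd, funext (hw.mollify_eq_convolution hs f),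
    (hw.pd j).mollify_eq_convolution hs f]
  have h3 := h2.fderiv
  simp only [Function.comp_def] at h3
  rw [h3]
  simp only [ContinuousLinearMap.comp_apply, smul_apply, ContinuousLinearMap.id_apply,
    map_smul]
  rw [convolution_precompR_apply _ hli (hcs.fderiv ℝ) (hsm1.continuous_fderiv one_ne_zero)]
  have h4 : (fun a => fderiv ℝ (fun z => w (-z)) a (Pi.single j 1))
      = fun a => -_root_.pd j w (-a) := by
    funext a
    have h5 := (hw.smooth.differentiable (by simp) (-a)).hasFDerivAt.comp a (hasFDerivAt_id a).neg
    have h6 := h5.fderiv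
    simp only [Function.comp_def] at h6
    rw [h6]
    simp [_root_.pd]
  rw [h4, smul_eq_mul, neg_mul, ← mul_neg]
  congr 1
  rw [convolution, convolution, ← integral_neg]
  simp

theorem periodic_mollify (hf : PeriodicZ3 f) : PeriodicZ3 (mollify w s f) := hf.tavg

theorem smooth_mollify (hw : IsMollifier w) (hs : 0 < s) (hf : Measurable f)
    (hC : ∀ x, |f x| ≤ C) (hper : PeriodicZ3 f) : SmoothPeriodic (mollify w s f) :=
  ⟨hw.contDiff_mollify hs hf hC, periodic_mollify hper⟩

end IsMollifier

theorem volume_real_closedBall (x : Dom3) {r : ℝ} (hr : 0 ≤ r) :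
    volume.real (Metric.closedBall x r) = (2 * r) ^ 3 := by
  rw [measureReal_def, Real.volume_pi_closedBall _ hr]
  simp [ENNReal.toReal_ofReal (by positivity : 0 ≤ (2 * r) ^ 3)]

open scoped Pointwise in
theorem abs_mollify_le {w f : Dom3 → ℝ} {s B c : ℝ} {x : Dom3} (hs : 0 < s)
    (hB : ∀ y, |w y| ≤ B) (hf : Continuous f)
    (h : ∫ y in Metric.closedBall x s, |f y| ≤ c * s ^ 3) : |mollify w s f x| ≤ B * c := by
  have hB0 : 0 ≤ B := (abs_nonneg _).trans (hB 0)
  have hset : s • Metric.closedBall (0 : Dom3) 1 = Metric.closedBall 0 s := by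
    rw [smul_unitClosedBall, Real.norm_of_nonneg hs.le]
  have himg : (fun y => x + y) ⁻¹' Metric.closedBall x s = Metric.closedBall 0 s := by
    ext y
    simp [dist_eq_norm]
  have hmp := measurePreserving_add_left (volume : Measure Dom3) x
  have hcv : ∫ y in Metric.closedBall (0 : Dom3) 1, |f (x + s • y)|
      = (s ^ 3)⁻¹ * ∫ y in Metric.closedBall x s, |f y| := by
    rw [Measure.setIntegral_comp_smul volume (fun y => |f (x + y)|) _ hs.ne', hset,
      ← hmp.setIntegral_preimage_emb (measurableEmbedding_addLeft x) (fun y => |f y|), himg]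
    simp [abs_of_pos hs]
  have hint : IntegrableOn (fun y => |f (x + s • y)|) (Metric.closedBall 0 1) :=
    ContinuousOn.integrableOn_compact (isCompact_closedBall 0 1) (by fun_prop)
  rw [← Real.norm_eq_abs]
  calc ‖mollify w s f x‖ ≤ ∫ y in Metric.closedBall (0 : Dom3) 1, B * |f (x + s • y)| := by
        refine norm_integral_le_of_norm_le (hint.const_mul B)
          (Filter.Eventually.of_forall fun y => ?_)
        rw [norm_smul]
        exact mul_le_mul_of_nonneg_right (hB y) (abs_nonneg _)
    _ = B * ((s ^ 3)⁻¹ * ∫ y in Metric.closedBall x s, |f y|) := by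
        rw [integral_const_mul, hcv]
    _ ≤ B * ((s ^ 3)⁻¹ * (c * s ^ 3)) := by gcongr
    _ = B * c := by field_simp

/-! ### Smooth truncation: kernels and local estimates -/

/-- Even mollifiers of unit mass. -/
structure IsBump (w : Dom3 → ℝ) : Prop extends IsMollifier w where
  even : ∀ y, w (-y) = w y
  mass : ∫ y, w y = 1

theorem exists_isBump : ∃ w, IsBump w := by
  let b : ContDiffBump (0 : Dom3) := ⟨1 / 8, 1 / 4, by norm_num, by norm_num⟩
  refine ⟨b.normed volume, ⟨⟨b.contDiff_normed, fun y hy => ?_⟩,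
    fun y => b.normed_neg y, b.integral_normed⟩⟩
  by_contra h
  have h1 : y ∈ Function.support (b.normed volume) := h
  rw [b.support_normed_eq, Metric.mem_ball, dist_zero_right] at h1
  exact hy.not_gt h1

theorem abs_tavg_le {Ω : Type*} [MeasurableSpace Ω] {ν : Measure Ω} [IsFiniteMeasure ν]
    {a : Ω → ℝ} {e : Ω → Dom3} {f : Dom3 → ℝ} {A ρ S : ℝ} {x : Dom3}
    (hA : ∀ ω, |a ω| ≤ A) (he : ∀ ω, a ω ≠ 0 → ‖e ω‖ ≤ ρ) (hS : 0 ≤ S)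
    (hf : ∀ z, ‖z - x‖ ≤ ρ → |f z| ≤ S) : |tavg ν a e f x| ≤ A * S * ν.real univ := by
  rw [← Real.norm_eq_abs, tavg]
  refine norm_integral_le_of_norm_le_const (μ := ν) (Filter.Eventually.of_forall fun ω => ?_)
  rw [norm_smul, Real.norm_eq_abs, Real.norm_eq_abs]
  by_cases h0 : a ω = 0
  · rw [h0, abs_zero, zero_mul]
    exact mul_nonneg ((abs_nonneg _).trans (hA ω)) hS
  · exact mul_le_mul (hA ω) (hf _ (by simpa using he ω h0)) (abs_nonneg _)
      ((abs_nonneg _).trans (hA ω))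

theorem AvgKernel.abs_remOp_le {Ω : Type*} [MeasurableSpace Ω] {ν : Measure Ω}
    [IsFiniteMeasure ν] {a : Ω → ℝ} {e : Ω → Dom3} {f : Dom3 → ℝ} {A ρ S : ℝ} {x : Dom3}
    (h : AvgKernel ν a e A ρ) (p q : Fin 3) (hS : 0 ≤ S)
    (hf : ∀ z, ‖z - x‖ ≤ ρ → |f z| ≤ S) :
    |remOp ν a e p q f x| ≤ A * ρ * ρ * S * ν.real univ := by
  have h1 : (ν.prod (volume.restrict (Ioc (0 : ℝ) 1))).real univ = ν.real univ := by
    simp [measureReal_def, ← univ_prod_univ]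
  rw [← h1]
  refine abs_tavg_le (h.abs_remWeight_le p q) (fun ω hω => ?_) hS hf
  have h2 : a ω.1 ≠ 0 := fun h0 => hω (by simp [h0])
  have h3 : |ω.2| ≤ 1 := by
    by_contra h0
    exact hω (by rw [max_eq_left (by linarith), mul_zero])
  rw [norm_smul, Real.norm_eq_abs]
  exact (mul_le_of_le_one_left (norm_nonneg _) h3).trans (h.shift_le ω.1 h2)

theorem tavg_add {Ω : Type*} [MeasurableSpace Ω] {ν : Measure Ω} [IsFiniteMeasure ν]
    {a : Ω → ℝ} {e : Ω → Dom3} {f g : Dom3 → ℝ} {A : ℝ} (ha : Measurable a)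
    (hA : ∀ ω, |a ω| ≤ A) (he : Measurable e) (hf : SmoothPeriodic f) (hg : SmoothPeriodic g)
    (x : Dom3) : tavg ν a e (fun y => f y + g y) x = tavg ν a e f x + tavg ν a e g x := by
  simp only [tavg, smul_add]
  exact integral_add (integrable_tavg ha hA he hf.2 hf.continuous x)
    (integrable_tavg ha hA he hg.2 hg.continuous x)

namespace IsMollifier

variable {w f : Dom3 → ℝ} {r s B S : ℝ}

instance : IsFiniteMeasure ((volume : Measure Dom3).restrict (Metric.closedBall 0 1)) :=
  ⟨by simp⟩

theorem measureReal_restrict_closedBall :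
    ((volume : Measure Dom3).restrict (Metric.closedBall 0 1)).real univ = 8 := by
  rw [measureReal_restrict_apply MeasurableSet.univ, univ_inter,
    volume_real_closedBall _ zero_le_one]
  norm_num

theorem shift_le (hw : IsMollifier w) (hs : 0 < s) (y : Dom3) (hy : w y ≠ 0) :
    ‖s • y‖ ≤ s / 4 := by
  have h1 : ‖y‖ ≤ 1 / 4 := not_lt.1 fun h => hy (hw.eq_zero y h)
  rw [norm_smul, Real.norm_of_nonneg hs.le]
  nlinarith

theorem abs_mollify_le_of_ball (hw : IsMollifier w) (hB : ∀ y, |w y| ≤ B) (hs : 0 < s)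
    (hS : 0 ≤ S) {x : Dom3} (hf : ∀ z, ‖z - x‖ ≤ s / 4 → |f z| ≤ S) :
    |mollify w s f x| ≤ 8 * B * S := by
  have := abs_tavg_le (ν := volume.restrict (Metric.closedBall 0 1)) hB (hw.shift_le hs) hS hf
  rw [measureReal_restrict_closedBall] at this
  rw [mollify]
  linarith

theorem mollify_comm (hw : IsMollifier w) (hf : SmoothPeriodic f) (r s : ℝ) (x : Dom3) :
    mollify w r (mollify w s f) x = mollify w s (mollify w r f) x := by
  obtain ⟨B, hB0, hB⟩ := hw.exists_bound
  obtain ⟨C, hC0, hC⟩ := hf.exists_bound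
  simp only [mollify, tavg, smul_eq_mul, ← integral_const_mul]
  rw [integral_integral_swap]
  · congr 1
    funext y
    congr 1
    funext z
    rw [add_right_comm]
    ring
  · refine Integrable.of_bound (C := B * (B * C)) ?_ (Filter.Eventually.of_forall fun ω => ?_)
    · have := hw.smooth.continuous
      have := hf.continuous
      refine Continuous.aestronglyMeasurable ?_
      simp only [Function.uncurry_def]
      fun_prop
    · simp only [Function.uncurry_def, Real.norm_eq_abs, abs_mul]
      exact mul_le_mul (hB _) (mul_le_mul (hB _) (hC _) (abs_nonneg _) hB0) (by positivity) hB0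

end IsMollifier

theorem IsBump.avgKernel {w : Dom3 → ℝ} {s B : ℝ} (hw : IsBump w) (hB : ∀ y, |w y| ≤ B)
    (hs : 0 < s) : AvgKernel (volume.restrict (Metric.closedBall 0 1)) w (fun y => s • y) B
      (s / 4) where
  measurable_weight := hw.smooth.continuous.measurable
  measurable_shift := measurable_const_smul s
  weight_le := hB
  shift_le := hw.shift_le hs
  mass := by
    have := hw.mollify_eq s (fun _ => 1) 0
    simpa [mollify, tavg, hw.mass] using this
  moment i := by
    have h1 : ∫ y in Metric.closedBall (0 : Dom3) 1, w y * (s • y) i = ∫ y, w y * (s • y) i := by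
      refine setIntegral_eq_integral_of_forall_compl_eq_zero fun y hy => ?_
      rw [Metric.mem_closedBall, dist_zero_right, not_le] at hy
      rw [hw.eq_zero y (by linarith), zero_mul]
    have h2 := integral_neg_eq_self (fun y : Dom3 => w y * (s • y) i) volume
    simp only [hw.even, smul_neg, Pi.neg_apply, mul_neg, integral_neg] at h2
    rw [h1]
    linarith

/-- The sum of the mollifications of a matrix field at the scales `r` and `r / 2`. -/
def twoScale (w : Dom3 → ℝ) (r : ℝ) (u : Fin 3 → Fin 3 → Dom3 → ℝ) (i j : Fin 3) (x : Dom3) : ℝ :=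
  mollify w r (u i j) x + mollify w (r / 2) (u i j) x

/-- The potential relating the twice mollified stress fields at the scales `r` and `r / 2`. -/
def scalePotential (w : Dom3 → ℝ) (r : ℝ) (u : Fin 3 → Fin 3 → Dom3 → ℝ) (i k j l : Fin 3)
    (x : Dom3) : ℝ :=
  avgPotential (volume.restrict (Metric.closedBall 0 1)) w (fun y => r • y) (twoScale w r u)
      i k j l x
    - avgPotential (volume.restrict (Metric.closedBall 0 1)) w (fun y => (r / 2) • y)
      (twoScale w r u) i k j l x

theorem AvgKernel.pd_avgPotential {Ω : Type*} [MeasurableSpace Ω] {ν : Measure Ω}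
    [IsFiniteMeasure ν] {a : Ω → ℝ} {e : Ω → Dom3} {A ρ : ℝ} {u : Fin 3 → Fin 3 → Dom3 → ℝ}
    (h : AvgKernel ν a e A ρ) (hu : ∀ i j, SmoothPeriodic (u i j)) (m i k j l : Fin 3) (x : Dom3) :
    pd m (avgPotential ν a e u i k j l) x
      = avgPotential ν a e (fun i j => pd m (u i j)) i k j l x := by
  have s1 := h.smooth_remOp (hu i j) k l
  have s2 := h.smooth_remOp (hu k j) i l
  have s3 := h.smooth_remOp (hu i l) k j
  have s4 := h.smooth_remOp (hu k l) i j
  rw [show avgPotential ν a e u i k j l = fun x => remOp ν a e k l (u i j) x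
    - remOp ν a e i l (u k j) x - remOp ν a e k j (u i l) x + remOp ν a e i j (u k l) x from rfl,
    pd_add ((s1.sub s2).sub s3) s4, pd_sub (s1.sub s2) s3, pd_sub s1 s2, h.pd_remOp (hu i j),
    h.pd_remOp (hu k j), h.pd_remOp (hu i l), h.pd_remOp (hu k l), avgPotential]

theorem AvgKernel.abs_avgPotential_le {Ω : Type*} [MeasurableSpace Ω] {ν : Measure Ω}
    [IsFiniteMeasure ν] {a : Ω → ℝ} {e : Ω → Dom3} {A ρ S : ℝ} {u : Fin 3 → Fin 3 → Dom3 → ℝ}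
    {x : Dom3} (h : AvgKernel ν a e A ρ) (hS : 0 ≤ S)
    (hu : ∀ z, ‖z - x‖ ≤ ρ → ∀ i j, |u i j z| ≤ S) (i k j l : Fin 3) :
    |avgPotential ν a e u i k j l x| ≤ 4 * (A * ρ * ρ * S * ν.real univ) := by
  have h1 := h.abs_remOp_le k l hS fun z hz => hu z hz i j
  have h2 := h.abs_remOp_le i l hS fun z hz => hu z hz k j
  have h3 := h.abs_remOp_le k j hS fun z hz => hu z hz i l
  have h4 := h.abs_remOp_le i j hS fun z hz => hu z hz k l
  rw [avgPotential]
  rw [abs_le] at h1 h2 h3 h4 ⊢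
  constructor <;> linarith [h1.1, h1.2, h2.1, h2.2, h3.1, h3.2, h4.1, h4.2]

theorem abs_ddiv_mul_le {R : Fin 3 → Fin 3 → Fin 3 → Fin 3 → Dom3 → ℝ} (hR : IsPotential R)
    {χ : Dom3 → ℝ} (hχ : SmoothPeriodic χ) {x : Dom3} {r a b d : ℝ} (hr : 0 < r) (ha : 0 ≤ a)
    (h0 : |χ x| ≤ a) (h1 : ∀ k, |pd k χ x| ≤ r⁻¹ * a)
    (h2 : ∀ k l, |pd k (pd l χ) x| ≤ r⁻¹ * (r⁻¹ * a)) (hR0 : ∀ i k j l, |R i k j l x| ≤ b * r ^ 2)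
    (hR1 : ∀ m i k j l, |pd m (R i k j l) x| ≤ b * r) (i j : Fin 3) (hd : |ddiv R i j x| ≤ d) :
    |ddiv (fun i k j l x => χ x * R i k j l x) i j x| ≤ a * d + 27 * (a * b) := by
  rw [hR.ddiv_mul hχ]
  have hprod : ∀ m n k l, |pd m χ x * pd n (R i k j l) x| ≤ a * b := by
    intro m n k l
    rw [abs_mul]
    calc _ ≤ (r⁻¹ * a) * (b * r) := mul_le_mul (h1 m) (hR1 n i k j l) (abs_nonneg _) (by positivity)
      _ = a * b := by field_simp
  have hterm : ∀ k l, |pd k (pd l χ) x * R i k j l x + pd l χ x * pd k (R i k j l) x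
      + pd k χ x * pd l (R i k j l) x| ≤ 3 * (a * b) := by
    intro k l
    have e1 : |pd k (pd l χ) x * R i k j l x| ≤ a * b := by
      rw [abs_mul]
      calc _ ≤ (r⁻¹ * (r⁻¹ * a)) * (b * r ^ 2) :=
            mul_le_mul (h2 k l) (hR0 i k j l) (abs_nonneg _) (by positivity)
        _ = a * b := by field_simp
    refine (abs_add_three _ _ _).trans ?_
    linarith [hprod l k k l, hprod k l k l]
  refine (abs_add_le _ _).trans (add_le_add ?_ ?_)
  · rw [abs_mul]
    exact mul_le_mul h0 hd (abs_nonneg _) ha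
  · refine (Finset.abs_sum_le_sum_abs _ _).trans ((Finset.sum_le_sum fun k _ =>
      (Finset.abs_sum_le_sum_abs _ _).trans (Finset.sum_le_sum fun l _ => hterm k l)).trans ?_)
    simp only [Finset.sum_const, Finset.card_univ, Fintype.card_fin, nsmul_eq_mul]
    push_cast
    linarith

section scalePotential

variable {w : Dom3 → ℝ} {u : Fin 3 → Fin 3 → Dom3 → ℝ} {B r s c : ℝ} {x : Dom3}

theorem IsMollifier.smoothPeriodic_mollify {f : Dom3 → ℝ} (hw : IsMollifier w) (hs : 0 < s)
    (hf : SmoothPeriodic f) : SmoothPeriodic (mollify w s f) := by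
  obtain ⟨C, -, hC⟩ := hf.exists_bound
  exact hw.smooth_mollify hs hf.continuous.measurable hC hf.2

theorem IsBump.stressField_mollify (hw : IsBump w) (hu : StressField u) (hs : 0 < s) :
    StressField fun i j => mollify w s (u i j) := by
  obtain ⟨B, -, hB⟩ := hw.exists_bound
  exact (hw.avgKernel hB hs).stressField_tavg hu

theorem IsBump.stressField_twoScale (hw : IsBump w) (hu : StressField u) (hr : 0 < r) :
    StressField (twoScale w r u) :=
  (hw.stressField_mollify hu hr).add (hw.stressField_mollify hu (half_pos hr))

theorem IsBump.isPotential_scalePotential (hw : IsBump w) (hu : StressField u) (hr : 0 < r) :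
    IsPotential (scalePotential w r u) := by
  obtain ⟨B, -, hB⟩ := hw.exists_bound
  exact ((hw.avgKernel hB hr).isPotential (hw.stressField_twoScale hu hr)).sub
    ((hw.avgKernel hB (half_pos hr)).isPotential (hw.stressField_twoScale hu hr))

theorem IsBump.mollify_twoScale (hw : IsBump w) (hu : StressField u) (hr : 0 < r) (i j : Fin 3)
    (x : Dom3) : mollify w s (twoScale w r u i j) x
      = mollify w s (mollify w r (u i j)) x + mollify w s (mollify w (r / 2) (u i j)) x := by
  obtain ⟨B, -, hB⟩ := hw.exists_bound
  exact tavg_add hw.smooth.continuous.measurable hB (measurable_const_smul s)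
    (hw.smoothPeriodic_mollify hr (hu.smooth i j))
    (hw.smoothPeriodic_mollify (half_pos hr) (hu.smooth i j)) x

theorem IsBump.ddiv_scalePotential (hw : IsBump w) (hu : StressField u) (hr : 0 < r) (i j : Fin 3)
    (x : Dom3) : ddiv (scalePotential w r u) i j x
      = mollify w r (mollify w r (u i j)) x - mollify w (r / 2) (mollify w (r / 2) (u i j)) x := by
  obtain ⟨B, -, hB⟩ := hw.exists_bound
  have h1 := hw.avgKernel hB hr
  have h2 := hw.avgKernel hB (half_pos hr)
  have hT := hw.stressField_twoScale hu hr
  have e := (h1.isPotential hT).ddiv_sub (h2.isPotential hT) i j x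
  rw [h1.ddiv_avgPotential hT, h2.ddiv_avgPotential hT] at e
  refine e.trans ?_
  change mollify w r (twoScale w r u i j) x - _ - (mollify w (r / 2) (twoScale w r u i j) x - _) = _
  rw [hw.mollify_twoScale hu hr, hw.mollify_twoScale hu hr,
    hw.mollify_comm (hu.smooth i j) (r / 2) r]
  ring

/-- The averages of a matrix field are bounded by `c` on balls near `x` of radius about `r`. -/
def AvgBound (u : Fin 3 → Fin 3 → Dom3 → ℝ) (c r : ℝ) (x : Dom3) : Prop :=
  ∀ z, ‖z - x‖ ≤ r → ∀ s, r / 2 ≤ s → s ≤ r → ∀ i j,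
    ∫ y in Metric.closedBall z s, |u i j y| ≤ c * s ^ 3

theorem AvgBound.abs_mollify_le (h : AvgBound u c r x) (hu : ∀ i j, SmoothPeriodic (u i j))
    (hr : 0 < r) (hB : ∀ y, |w y| ≤ B) (hs : r / 2 ≤ s) (hsr : s ≤ r) {z : Dom3}
    (hz : ‖z - x‖ ≤ r) (i j : Fin 3) : |mollify w s (u i j) z| ≤ B * c :=
  _root_.abs_mollify_le ((half_pos hr).trans_le hs) hB (hu i j).continuous (h z hz s hs hsr i j)

theorem AvgBound.const_nonneg (h : AvgBound u c r x) (hr : 0 < r) : 0 ≤ c := by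
  have h1 := h x (by simpa using hr.le) r (half_le_self hr.le) le_rfl 0 0
  have h2 : 0 ≤ ∫ y in Metric.closedBall x r, |u 0 0 y| := by positivity
  have h3 : 0 < r ^ 3 := by positivity
  exact nonneg_of_mul_nonneg_left (h2.trans h1) h3

theorem AvgBound.abs_mollify_mollify_le (h : AvgBound u c r x)
    (hu : ∀ i j, SmoothPeriodic (u i j)) (hr : 0 < r) (hw : IsMollifier w) (hB : ∀ y, |w y| ≤ B)
    (hs : r / 2 ≤ s) (hsr : s ≤ r) (i j : Fin 3) :
    |mollify w s (mollify w s (u i j)) x| ≤ 8 * B * (B * c) := by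
  have hs0 := (half_pos hr).trans_le hs
  have hB0 : 0 ≤ B := (abs_nonneg _).trans (hB 0)
  exact hw.abs_mollify_le_of_ball hB hs0 (mul_nonneg hB0 (h.const_nonneg hr)) fun z hz =>
    h.abs_mollify_le hu hr hB hs hsr (by linarith) i j

theorem AvgBound.abs_scalePotential_le (h : AvgBound u c r x) (hu : StressField u) (hr : 0 < r)
    (hw : IsBump w) (hB : ∀ y, |w y| ≤ B) (i k j l : Fin 3) :
    |scalePotential w r u i k j l x| ≤ 8 * B ^ 2 * c * r ^ 2 := by
  have hc := h.const_nonneg hr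
  have hB0 : 0 ≤ B := (abs_nonneg _).trans (hB 0)
  have hT : ∀ z, ‖z - x‖ ≤ r → ∀ i j, |twoScale w r u i j z| ≤ 2 * (B * c) := by
    intro z hz i j
    have e1 := h.abs_mollify_le hu.smooth hr hB (half_le_self hr.le) le_rfl hz i j
    have e2 := h.abs_mollify_le hu.smooth hr hB le_rfl (half_le_self hr.le) hz i j
    exact (abs_add_le _ _).trans (by linarith)
  have hBc : 0 ≤ 2 * (B * c) := by positivity
  have h1 := (hw.avgKernel hB hr).abs_avgPotential_le hBc
    (x := x)
    (fun z hz => hT z (by linarith)) i k j l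
  have h2 := (hw.avgKernel hB (half_pos hr)).abs_avgPotential_le hBc
    (x := x)
    (fun z hz => hT z (by linarith)) i k j l
  rw [IsMollifier.measureReal_restrict_closedBall] at h1 h2
  refine (abs_sub _ _).trans ((add_le_add h1 h2).trans ?_)
  have : 0 ≤ B ^ 2 * c * r ^ 2 := by positivity
  nlinarith

theorem AvgBound.abs_pd_scalePotential_le (h : AvgBound u c r x) (hu : StressField u)
    (hr : 0 < r) (hw : IsBump w) (hB : ∀ y, |w y| ≤ B) (hB1 : ∀ m y, |pd m w y| ≤ B)
    (m i k j l : Fin 3) : |pd m (scalePotential w r u i k j l) x| ≤ 8 * B ^ 2 * c * r := by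
  have hc := h.const_nonneg hr
  have hB0 : 0 ≤ B := (abs_nonneg _).trans (hB 0)
  have hsT := (hw.stressField_twoScale hu hr).smooth
  have hT : ∀ z, ‖z - x‖ ≤ r → ∀ i j, |pd m (twoScale w r u i j) z| ≤ 3 * r⁻¹ * (B * c) := by
    intro z hz i j
    have e1 := h.abs_mollify_le hu.smooth hr (hB1 m) (half_le_self hr.le) le_rfl hz i j
    have e2 := h.abs_mollify_le hu.smooth hr (hB1 m) le_rfl (half_le_self hr.le) hz i j
    obtain ⟨C, -, hC⟩ := (hu.smooth i j).exists_bound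
    have hm := (hu.smooth i j).continuous.measurable
    rw [show twoScale w r u i j = fun x => mollify w r (u i j) x + mollify w (r / 2) (u i j) x
      from rfl, pd_add (hw.smoothPeriodic_mollify hr (hu.smooth i j))
      (hw.smoothPeriodic_mollify (half_pos hr) (hu.smooth i j)), hw.pd_mollify hr hm hC,
      hw.pd_mollify (half_pos hr) hm hC]
    refine (abs_add_le _ _).trans ?_
    rw [abs_mul, abs_mul, abs_neg, abs_neg, abs_of_pos (inv_pos.2 hr),
      abs_of_pos (inv_pos.2 (half_pos hr))]
    calc _ ≤ r⁻¹ * (B * c) + (r / 2)⁻¹ * (B * c) := by gcongr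
      _ = _ := by field_simp; ring
  have hBc : 0 ≤ 3 * r⁻¹ * (B * c) := by positivity
  have k1 := hw.avgKernel hB hr
  have k2 := hw.avgKernel hB (half_pos hr)
  have h1 := k1.abs_avgPotential_le (u := fun i j => pd m (twoScale w r u i j)) hBc
    (x := x)
    (fun z hz => hT z (by linarith)) i k j l
  have h2 := k2.abs_avgPotential_le (u := fun i j => pd m (twoScale w r u i j)) hBc
    (x := x)
    (fun z hz => hT z (by linarith)) i k j l
  rw [IsMollifier.measureReal_restrict_closedBall] at h1 h2
  rw [show scalePotential w r u i k j l = fun x => avgPotential _ w _ (twoScale w r u) i k j l x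
    - avgPotential _ w _ (twoScale w r u) i k j l x from rfl,
    pd_sub ((k1.isPotential (hw.stressField_twoScale hu hr)).smooth i k j l)
      ((k2.isPotential (hw.stressField_twoScale hu hr)).smooth i k j l), k1.pd_avgPotential hsT,
    k2.pd_avgPotential hsT]
  refine (abs_sub _ _).trans ((add_le_add h1 h2).trans ?_)
  calc _ = 15 / 2 * (B ^ 2 * c * r) := by field_simp; ring
    _ ≤ 8 * (B ^ 2 * c * r) := by gcongr; norm_num
    _ = _ := by ring

theorem AvgBound.abs_ddiv_cutoff_le (h : AvgBound u c r x) (hu : StressField u)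
    (hr : 0 < r) (hw : IsBump w) (hB : ∀ y, |w y| ≤ B) (hB1 : ∀ m y, |pd m w y| ≤ B)
    {χ : Dom3 → ℝ} (hχ : SmoothPeriodic χ) {a : ℝ} (ha : 0 ≤ a)
    (h0 : |χ x| ≤ a) (h1 : ∀ k, |pd k χ x| ≤ r⁻¹ * a)
    (h2 : ∀ k l, |pd k (pd l χ) x| ≤ r⁻¹ * (r⁻¹ * a)) (i j : Fin 3) :
    |ddiv (fun i k j l x => χ x * scalePotential w r u i k j l x) i j x|
      ≤ 232 * (a * (B ^ 2 * c)) := by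
  have hc := h.const_nonneg hr
  have hd : |ddiv (scalePotential w r u) i j x| ≤ 16 * (B ^ 2 * c) := by
    rw [hw.ddiv_scalePotential hu hr]
    refine (abs_sub _ _).trans ?_
    have e1 := h.abs_mollify_mollify_le hu.smooth hr hw.toIsMollifier hB (half_le_self hr.le)
      le_rfl i j
    have e2 := h.abs_mollify_mollify_le hu.smooth hr hw.toIsMollifier hB le_rfl
      (half_le_self hr.le) i j
    linarith
  have := abs_ddiv_mul_le (hw.isPotential_scalePotential hu hr) hχ hr ha
    (b := 8 * B ^ 2 * c) h0 h1 h2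
    (fun i k j l => h.abs_scalePotential_le hu hr hw hB i k j l)
    (fun m i k j l => h.abs_pd_scalePotential_le hu hr hw hB hB1 m i k j l) i j hd
  linarith

end scalePotential

/-! ### Smooth truncation: the cutoff functions -/

/-- The dyadic scales. -/
def dyad (n : ℕ) : ℝ := (1 / 2) ^ n

theorem dyad_pos (n : ℕ) : 0 < dyad n := by
  unfold dyad
  positivity

theorem dyad_succ (n : ℕ) : dyad (n + 1) = dyad n / 2 := by
  rw [dyad, dyad, pow_succ]
  ring

theorem dyad_anti : Antitone dyad := fun _ _ h =>
  pow_le_pow_of_le_one (by norm_num) (by norm_num) h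

theorem dyad_le_one (n : ℕ) : dyad n ≤ 1 := pow_le_one₀ (by norm_num) (by norm_num)

/-- The region at scale `n` surrounding the bad points of the scales up to `n + 1`. -/
def badRegion (bad : ℕ → Set Dom3) (n : ℕ) : Set Dom3 :=
  ⋃ j ≤ n, ⋃ z ∈ bad (j + 1), Metric.ball z (3 * dyad j - 2 * dyad n)

/-- The points close to the bad region at scale `n`. -/
def nearBad (bad : ℕ → Set Dom3) (n : ℕ) : Set Dom3 :=
  {x | (Metric.ball x (dyad n / 2) ∩ badRegion bad n).Nonempty}

section badRegion

variable {bad : ℕ → Set Dom3} {n k : ℕ} {x : Dom3}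

theorem mem_badRegion : x ∈ badRegion bad n ↔
    ∃ j ≤ n, ∃ z ∈ bad (j + 1), dist x z < 3 * dyad j - 2 * dyad n := by
  simp [badRegion]

theorem isOpen_badRegion : IsOpen (badRegion bad n) :=
  isOpen_biUnion fun _ _ => isOpen_biUnion fun _ _ => Metric.isOpen_ball

theorem exists_bad_of_mem_nearBad (hx : x ∈ nearBad bad n) :
    ∃ j ≤ n, ∃ z ∈ bad (j + 1), dist x z < 3 * dyad j - 3 / 2 * dyad n := by
  obtain ⟨y, hyx, hy⟩ := hx
  obtain ⟨j, hj, z, hz, hyz⟩ := mem_badRegion.1 hy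
  refine ⟨j, hj, z, hz, ?_⟩
  rw [Metric.mem_ball, dist_comm] at hyx
  linarith [dist_triangle x y z]

theorem ball_subset_badRegion (hx : x ∈ nearBad bad n) (hk : n < k) :
    Metric.ball x (dyad k / 2) ⊆ badRegion bad k := by
  obtain ⟨j, hj, z, hz, hxz⟩ := exists_bad_of_mem_nearBad hx
  intro y hy
  have h1 : dyad k ≤ dyad n / 2 := dyad_succ n ▸ dyad_anti hk
  refine mem_badRegion.2 ⟨j, hj.trans hk.le, z, hz, ?_⟩
  rw [Metric.mem_ball] at hy
  linarith [dist_triangle y x z, dyad_pos n]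

theorem mem_nearBad_of_mem_bad (hx : x ∈ bad (n + 1)) : x ∈ nearBad bad n := by
  have := dyad_pos n
  refine ⟨x, Metric.mem_ball_self (half_pos this), mem_badRegion.2 ⟨n, le_rfl, x, hx, ?_⟩⟩
  rw [dist_self]
  linarith

theorem periodic_indicator_badRegion
    (hbad : ∀ n, ∀ z ∈ bad n, ∀ m : Fin 3 → ℤ, (z + fun i => (m i : ℝ)) ∈ bad n) (n : ℕ) :
    PeriodicZ3 ((badRegion bad n).indicator fun _ => (1 : ℝ)) := by
  have h1 : ∀ x ∈ badRegion bad n, ∀ m : Fin 3 → ℤ, (x + fun i => (m i : ℝ)) ∈ badRegion bad n := by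
    intro x hx m
    obtain ⟨j, hj, z, hz, hxz⟩ := mem_badRegion.1 hx
    exact mem_badRegion.2 ⟨j, hj, _, hbad _ z hz m, by rwa [dist_add_right]⟩
  intro x m
  by_cases hx : x ∈ badRegion bad n
  · rw [indicator_of_mem hx, indicator_of_mem (h1 x hx m)]
  · rw [indicator_of_notMem hx, indicator_of_notMem fun h => hx ?_]
    have := h1 _ h (-m)
    rwa [show ((x + fun i => (m i : ℝ)) + fun i => ((-m) i : ℝ)) = x by ext i; simp] at this

theorem measurable_indicator_badRegion :
    Measurable ((badRegion bad n).indicator fun _ => (1 : ℝ)) :=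
  measurable_const.indicator isOpen_badRegion.measurableSet

theorem abs_indicator_one_le (s : Set Dom3) (x : Dom3) :
    |s.indicator (fun _ => (1 : ℝ)) x| ≤ 1 := by
  by_cases hx : x ∈ s <;> simp [hx]

end badRegion

/-- The cutoff function at scale `n`. -/
def cutoff (w : Dom3 → ℝ) (bad : ℕ → Set Dom3) (n : ℕ) : Dom3 → ℝ :=
  mollify w (dyad n) ((badRegion bad n).indicator fun _ => (1 : ℝ))

theorem IsBump.mollify_eventuallyEq_const {w f : Dom3 → ℝ} (hw : IsBump w) {s c : ℝ} (hs : 0 < s)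
    {x : Dom3} (hf : ∀ y ∈ Metric.ball x (s / 2), f y = c) :
    mollify w s f =ᶠ[nhds x] fun _ => c := by
  filter_upwards [Metric.ball_mem_nhds x (show 0 < s / 4 by positivity)] with z hz
  rw [hw.mollify_eq]
  have : ∀ y, w y * f (z + s • y) = w y * c := by
    intro y
    by_cases h0 : w y = 0
    · rw [h0, zero_mul, zero_mul]
    · rw [hf _ (Metric.mem_ball.2 ((dist_triangle _ z _).trans_lt ?_))]
      have := hw.shift_le hs y h0
      rw [Metric.mem_ball] at hz
      rw [dist_self_add_left]
      linarith
  simp only [this, integral_mul_const, hw.mass, one_mul]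

section cutoff

variable {w : Dom3 → ℝ} {bad : ℕ → Set Dom3} {n : ℕ} {x : Dom3} {B : ℝ}

theorem IsMollifier.smooth_cutoff (hw : IsMollifier w)
    (hbad : ∀ n, ∀ z ∈ bad n, ∀ m : Fin 3 → ℤ, (z + fun i => (m i : ℝ)) ∈ bad n) (n : ℕ) :
    SmoothPeriodic (cutoff w bad n) :=
  hw.smooth_mollify (dyad_pos n) measurable_indicator_badRegion (abs_indicator_one_le _)
    (periodic_indicator_badRegion hbad n)

theorem IsMollifier.abs_cutoff_le (hw : IsMollifier w) (hB : ∀ y, |w y| ≤ B) (n : ℕ) (x : Dom3) :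
    |cutoff w bad n x| ≤ 8 * B := by
  simpa [cutoff] using hw.abs_mollify_le_of_ball hB (dyad_pos n) zero_le_one
    (f := (badRegion bad n).indicator fun _ => (1 : ℝ)) (x := x)
    fun z _ => abs_indicator_one_le _ z

theorem IsMollifier.pd_cutoff (hw : IsMollifier w) (j : Fin 3) (n : ℕ) :
    _root_.pd j (cutoff w bad n) = fun x => -(dyad n)⁻¹ * cutoff (_root_.pd j w) bad n x :=
  funext fun x => hw.pd_mollify (dyad_pos n) measurable_indicator_badRegion
    (abs_indicator_one_le _) j x

theorem IsMollifier.abs_pd_cutoff_le (hw : IsMollifier w) (j : Fin 3)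
    (hB : ∀ y, |_root_.pd j w y| ≤ B) (n : ℕ) (x : Dom3) :
    |_root_.pd j (cutoff w bad n) x| ≤ (dyad n)⁻¹ * (8 * B) := by
  have hd := inv_pos.2 (dyad_pos n)
  rw [hw.pd_cutoff, abs_mul, abs_neg, abs_of_pos hd]
  exact mul_le_mul_of_nonneg_left ((hw.pd j).abs_cutoff_le hB n x) hd.le

theorem IsMollifier.abs_pd_pd_cutoff_le (hw : IsMollifier w)
    (hbad : ∀ n, ∀ z ∈ bad n, ∀ m : Fin 3 → ℤ, (z + fun i => (m i : ℝ)) ∈ bad n) (i j : Fin 3)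
    (hB : ∀ y, |_root_.pd i (_root_.pd j w) y| ≤ B) (n : ℕ) (x : Dom3) :
    |_root_.pd i (_root_.pd j (cutoff w bad n)) x| ≤ (dyad n)⁻¹ * ((dyad n)⁻¹ * (8 * B)) := by
  have hd := inv_pos.2 (dyad_pos n)
  rw [hw.pd_cutoff, pd_const_mul ((hw.pd j).smooth_cutoff hbad n), abs_mul, abs_neg,
    abs_of_pos hd]
  exact mul_le_mul_of_nonneg_left ((hw.pd j).abs_pd_cutoff_le i hB n x) hd.le

theorem IsBump.cutoff_eventuallyEq_zero (hw : IsBump w) (hx : x ∉ nearBad bad n) :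
    cutoff w bad n =ᶠ[nhds x] fun _ => 0 :=
  hw.mollify_eventuallyEq_const (dyad_pos n) fun y hy =>
    indicator_of_notMem (fun h => hx ⟨y, hy, h⟩) _

theorem IsBump.cutoff_eventuallyEq_one (hw : IsBump w)
    (hx : Metric.ball x (dyad n / 2) ⊆ badRegion bad n) :
    cutoff w bad n =ᶠ[nhds x] fun _ => 1 :=
  hw.mollify_eventuallyEq_const (dyad_pos n) fun _ hy => indicator_of_mem (hx hy) _

end cutoff

theorem IsPotential.ddiv_mul_of_eventuallyEq {R : Fin 3 → Fin 3 → Fin 3 → Fin 3 → Dom3 → ℝ}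
    (hR : IsPotential R) {χ : Dom3 → ℝ} (hχ : SmoothPeriodic χ) {x : Dom3} {c : ℝ}
    (h : χ =ᶠ[nhds x] fun _ => c) (i j : Fin 3) :
    ddiv (fun i k j l x => χ x * R i k j l x) i j x = c * ddiv R i j x := by
  have h1 : ∀ l, pd l χ =ᶠ[nhds x] fun _ => 0 := fun l =>
    (pd_congr_of_eventuallyEq h l).trans (Filter.Eventually.of_forall fun y => by simp [pd])
  have h2 : ∀ k l, pd k (pd l χ) x = 0 := fun k l => by
    rw [(pd_congr_of_eventuallyEq (h1 l) k).eq_of_nhds]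
    simp [pd]
  rw [hR.ddiv_mul hχ, h.eq_of_nhds]
  simp [h2, (h1 _).eq_of_nhds]

/-- The potential which removes the concentrations of `u` at scales above `dyad N`, and
mollifies `u` at scale `dyad N`. -/
def truncPotential (w : Dom3 → ℝ) (bad : ℕ → Set Dom3) (u : Fin 3 → Fin 3 → Dom3 → ℝ) (N : ℕ)
    (i k j l : Fin 3) (x : Dom3) : ℝ :=
  avgPotential (volume.restrict (Metric.closedBall 0 1)) w (fun y => dyad N • y)
      (fun i j x => mollify w (dyad N) (u i j) x + u i j x) i k j l x
    + ∑ n ∈ Finset.range N, cutoff w bad n x * scalePotential w (dyad n) u i k j l x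

section truncPotential

variable {w : Dom3 → ℝ} {bad : ℕ → Set Dom3} {u : Fin 3 → Fin 3 → Dom3 → ℝ} {N : ℕ} {x : Dom3}
  {B c : ℝ}

theorem IsBump.isPotential_cutoff_mul (hw : IsBump w) (hu : StressField u)
    (hbad : ∀ n, ∀ z ∈ bad n, ∀ m : Fin 3 → ℤ, (z + fun i => (m i : ℝ)) ∈ bad n) (n : ℕ) :
    IsPotential fun i k j l x => cutoff w bad n x * scalePotential w (dyad n) u i k j l x :=
  (hw.isPotential_scalePotential hu (dyad_pos n)).mul (hw.smooth_cutoff hbad n)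

theorem IsBump.isPotential_truncPotential (hw : IsBump w) (hu : StressField u)
    (hbad : ∀ n, ∀ z ∈ bad n, ∀ m : Fin 3 → ℤ, (z + fun i => (m i : ℝ)) ∈ bad n) (N : ℕ) :
    IsPotential (truncPotential w bad u N) := by
  obtain ⟨B, -, hB⟩ := hw.exists_bound
  exact ((hw.avgKernel hB (dyad_pos N)).isPotential
    ((hw.stressField_mollify hu (dyad_pos N)).add hu)).add
    (IsPotential.sum fun n _ => hw.isPotential_cutoff_mul hu hbad n)

theorem IsBump.add_ddiv_truncPotential (hw : IsBump w) (hu : StressField u)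
    (hbad : ∀ n, ∀ z ∈ bad n, ∀ m : Fin 3 → ℤ, (z + fun i => (m i : ℝ)) ∈ bad n) (N : ℕ)
    (i j : Fin 3) (x : Dom3) :
    u i j x + ddiv (truncPotential w bad u N) i j x
      = mollify w (dyad N) (mollify w (dyad N) (u i j)) x + ∑ n ∈ Finset.range N,
        ddiv (fun i k j l x => cutoff w bad n x * scalePotential w (dyad n) u i k j l x) i j x := by
  obtain ⟨B, -, hB⟩ := hw.exists_bound
  have hk := hw.avgKernel hB (dyad_pos N)
  have hs := (hw.stressField_mollify hu (dyad_pos N)).add hu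
  have e := (hk.isPotential hs).ddiv_add
    (IsPotential.sum (s := Finset.range N) fun n _ => hw.isPotential_cutoff_mul hu hbad n) i j x
  rw [IsPotential.ddiv_sum fun n _ => hw.isPotential_cutoff_mul hu hbad n,
    hk.ddiv_avgPotential hs, tavg_add hw.smooth.continuous.measurable hB (measurable_const_smul _)
    (hw.smoothPeriodic_mollify (dyad_pos N) (hu.smooth i j)) (hu.smooth i j)] at e
  refine (congrArg (u i j x + ·) e).trans ?_
  simp only [mollify]
  ring

theorem IsBump.ddiv_cutoff_mul_of_notMem (hw : IsBump w) (hu : StressField u)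
    (hbad : ∀ n, ∀ z ∈ bad n, ∀ m : Fin 3 → ℤ, (z + fun i => (m i : ℝ)) ∈ bad n) {n : ℕ}
    (hx : x ∉ nearBad bad n) (i j : Fin 3) :
    ddiv (fun i k j l x => cutoff w bad n x * scalePotential w (dyad n) u i k j l x) i j x = 0 := by
  rw [(hw.isPotential_scalePotential hu (dyad_pos n)).ddiv_mul_of_eventuallyEq
    (hw.smooth_cutoff hbad n) (hw.cutoff_eventuallyEq_zero hx), zero_mul]

theorem IsBump.add_ddiv_truncPotential_of_notMem (hw : IsBump w) (hu : StressField u)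
    (hbad : ∀ n, ∀ z ∈ bad n, ∀ m : Fin 3 → ℤ, (z + fun i => (m i : ℝ)) ∈ bad n)
    (hx : ∀ n < N, x ∉ nearBad bad n) (i j : Fin 3) :
    u i j x + ddiv (truncPotential w bad u N) i j x
      = mollify w (dyad N) (mollify w (dyad N) (u i j)) x := by
  rw [hw.add_ddiv_truncPotential hu hbad, Finset.sum_eq_zero fun n hn =>
    hw.ddiv_cutoff_mul_of_notMem hu hbad (hx n (Finset.mem_range.1 hn)) i j, add_zero]

theorem IsBump.add_ddiv_truncPotential_of_mem (hw : IsBump w) (hu : StressField u)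
    (hbad : ∀ n, ∀ z ∈ bad n, ∀ m : Fin 3 → ℤ, (z + fun i => (m i : ℝ)) ∈ bad n) {k : ℕ}
    (hk : k < N) (hlt : ∀ n < k, x ∉ nearBad bad n) (hx : x ∈ nearBad bad k) (i j : Fin 3) :
    u i j x + ddiv (truncPotential w bad u N) i j x
      = mollify w (dyad (k + 1)) (mollify w (dyad (k + 1)) (u i j)) x
        + ddiv (fun i k' j l x => cutoff w bad k x * scalePotential w (dyad k) u i k' j l x)
          i j x := by
  rw [hw.add_ddiv_truncPotential hu hbad]
  induction N, Nat.succ_le_of_lt hk using Nat.le_induction with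
  | base =>
    rw [Finset.sum_range_succ, Finset.sum_eq_zero fun n hn =>
      hw.ddiv_cutoff_mul_of_notMem hu hbad (hlt n (Finset.mem_range.1 hn)) i j, zero_add]
  | succ M hM ih =>
    rw [← ih hM, Finset.sum_range_succ,
      (hw.isPotential_scalePotential hu (dyad_pos M)).ddiv_mul_of_eventuallyEq
      (hw.smooth_cutoff hbad M) (hw.cutoff_eventuallyEq_one (ball_subset_badRegion hx hM)),
      hw.ddiv_scalePotential hu (dyad_pos M), ← dyad_succ]
    ring

theorem IsBump.abs_add_ddiv_truncPotential_le (hw : IsBump w) (hu : StressField u)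
    (hbad : ∀ n, ∀ z ∈ bad n, ∀ m : Fin 3 → ℤ, (z + fun i => (m i : ℝ)) ∈ bad n)
    (hbad0 : bad 0 = ∅) (hc : ∀ n x, x ∉ bad n → AvgBound u c (dyad n) x)
    (hB : ∀ y, |w y| ≤ B) (hB1 : ∀ m y, |pd m w y| ≤ B) (hB2 : ∀ k l y, |pd k (pd l w) y| ≤ B)
    (i j : Fin 3) (x : Dom3) :
    |u i j x + ddiv (truncPotential w bad u N) i j x| ≤ 8 * B ^ 2 * c + 1856 * B ^ 3 * c := by
  have hB0 : 0 ≤ B := (abs_nonneg _).trans (hB 0)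
  have hc0 : 0 ≤ c := (hc 0 0 (by simp [hbad0])).const_nonneg (dyad_pos 0)
  have hnb : ∀ k, (∀ n < k, x ∉ nearBad bad n) → AvgBound u c (dyad k) x := by
    intro k hk
    refine hc k x fun hx => ?_
    cases k with
    | zero => simp [hbad0] at hx
    | succ k => exact hk k k.lt_succ_self (mem_nearBad_of_mem_bad hx)
  by_cases h : ∃ n, n < N ∧ x ∈ nearBad bad n
  · classical
    have hlt : ∀ n < Nat.find h, x ∉ nearBad bad n := fun n hn hx =>
      Nat.find_min h hn ⟨hn.trans (Nat.find_spec h).1, hx⟩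
    have hb := hnb _ hlt
    set k := Nat.find h
    have hk : k < N ∧ x ∈ nearBad bad k := Nat.find_spec h
    rw [hw.add_ddiv_truncPotential_of_mem hu hbad hk.1 hlt hk.2]
    refine (abs_add_le _ _).trans ?_
    have e1 := hb.abs_mollify_mollify_le hu.smooth (dyad_pos k) hw.toIsMollifier hB
      (dyad_succ k).ge (dyad_anti k.le_succ) i j
    have e2 := hb.abs_ddiv_cutoff_le hu (dyad_pos k) hw hB hB1 (hw.smooth_cutoff hbad k)
      (a := 8 * B) (by positivity) (hw.abs_cutoff_le hB k x)
      (fun l => hw.abs_pd_cutoff_le l (hB1 l) k x)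
      (fun l m => hw.abs_pd_pd_cutoff_le hbad l m (hB2 l m) k x) i j
    linarith
  · push Not at h
    rw [hw.add_ddiv_truncPotential_of_notMem hu hbad h]
    have e1 := (hnb N h).abs_mollify_mollify_le hu.smooth (dyad_pos N) hw.toIsMollifier hB
      (half_le_self (dyad_pos N).le) le_rfl i j
    have : 0 ≤ B ^ 3 * c := by positivity
    linarith

end truncPotential

/-! ### Smooth truncation: the bad points -/

theorem PeriodicZ3.setLIntegral_closedBall_le {f : Dom3 → ENNReal} (hf : PeriodicZ3 f) (z : Dom3)
    (n : ℕ) : ∫⁻ y in Metric.closedBall z n, f y ≤ (2 * n + 1) ^ 3 * ∫⁻ y in unitBox, f y := by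
  set S : Finset (Fin 3 → ℤ) := Fintype.piFinset fun _ => Finset.Icc (-(n : ℤ)) n with hS
  set c : S → Dom3 := fun m => z + fun i => ((m : Fin 3 → ℤ) i : ℝ) with hc
  have hcov : Metric.closedBall z n ⊆ ⋃ m : S, (fun y => y - c m) ⁻¹' unitBox := by
    intro y hy
    rw [Metric.mem_closedBall, dist_eq_norm, pi_norm_le_iff_of_nonneg (Nat.cast_nonneg n)] at hy
    have hm : (fun i => ⌊(y - z) i⌋) ∈ S := by
      refine Fintype.mem_piFinset.2 fun i => Finset.mem_Icc.2 ?_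
      have h1 := abs_le.1 (hy i)
      constructor
      · exact Int.le_floor.2 (by push_cast; exact h1.1)
      · exact_mod_cast (Int.floor_le _).trans h1.2
    refine mem_iUnion.2 ⟨⟨_, hm⟩, ?_⟩
    have := sub_floor_mem_unitBox (y - z)
    rwa [sub_sub] at this
  have hcard : (S.card : ENNReal) = (2 * n + 1) ^ 3 := by
    have h1 : S.card = (2 * n + 1) ^ 3 := by
      rw [hS, Fintype.card_piFinset]
      simp only [Int.card_Icc, Finset.prod_const, Finset.card_univ, Fintype.card_fin]
      congr 1
      omega
    rw [h1]
    push_cast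
    rfl
  calc ∫⁻ y in Metric.closedBall z n, f y
      ≤ ∫⁻ y in ⋃ m : S, (fun y => y - c m) ⁻¹' unitBox, f y := lintegral_mono_set hcov
    _ ≤ ∑' m : S, ∫⁻ y in (fun y => y - c m) ⁻¹' unitBox, f y := lintegral_iUnion_le _ _
    _ = ∑' _m : S, ∫⁻ y in unitBox, f y := by
        congr 1
        funext m
        rw [← hf.setLIntegral_add (c m)]
        simpa using (measurePreserving_sub_right volume (c m)).setLIntegral_comp_preimage_emb
          (measurableEmbedding_subRight (c m)) (fun y => f (c m + y)) unitBox
    _ = _ := by simp [tsum_fintype, hcard]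

/-- The points at which the mass of `h` concentrates at scale `r`. -/
def concSet (h : Dom3 → ENNReal) (r : ℝ) : Set Dom3 :=
  {z | ENNReal.ofReal (r ^ 3) < ∫⁻ y in Metric.closedBall z (2 * r), h y}

theorem concSet_add_mem {h : Dom3 → ENNReal} (hh : PeriodicZ3 h) {r : ℝ} {z : Dom3}
    (hz : z ∈ concSet h r) (m : Fin 3 → ℤ) : (z + fun i => (m i : ℝ)) ∈ concSet h r := by
  rw [concSet, mem_ofPred_eq] at hz ⊢
  refine hz.trans_eq ?_
  have h1 := (measurePreserving_add_right volume fun i => (m i : ℝ)).setLIntegral_comp_preimage_emb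
    (measurableEmbedding_addRight _) h (Metric.closedBall (z + fun i => (m i : ℝ)) (2 * r))
  simp only [hh _ m] at h1
  rw [← h1]
  congr 2
  ext y
  simp only [mem_preimage, Metric.mem_closedBall, dist_add_right]

theorem concSet_one_eq_empty {h : Dom3 → ENNReal} (hh : PeriodicZ3 h)
    (hsmall : 125 * ∫⁻ y in unitBox, h y ≤ 1) : concSet h 1 = ∅ := by
  refine eq_empty_of_forall_notMem fun z hz => ?_
  rw [concSet, mem_ofPred_eq, one_pow, ENNReal.ofReal_one, mul_one] at hz
  have h1 := hh.setLIntegral_closedBall_le z 2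
  norm_num at h1
  exact (hz.trans_le (h1.trans hsmall)).false

theorem avgBound_of_notMem_concSet {u : Fin 3 → Fin 3 → Dom3 → ℝ} {h : Dom3 → ℝ} {M r : ℝ}
    {x : Dom3} (hu : ∀ i j, Continuous (u i j)) (hh : Continuous h) (hh0 : ∀ x, 0 ≤ h x)
    (huh : ∀ i j x, |u i j x| ≤ M + h x) (hr : 0 < r)
    (hx : x ∉ concSet (fun y => ENNReal.ofReal (h y)) r) : AvgBound u (8 * (M + 1)) r x := by
  intro z hz s hrs hsr i j
  have hs : 0 < s := (half_pos hr).trans_le hrs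
  have hint : ∀ y t, IntegrableOn h (Metric.closedBall y t) := fun y t =>
    hh.continuousOn.integrableOn_compact (isCompact_closedBall y t)
  have hx' : ∫ y in Metric.closedBall x (2 * r), h y ≤ r ^ 3 := by
    rw [integral_eq_lintegral_of_nonneg_ae (Filter.Eventually.of_forall hh0)
      hh.aestronglyMeasurable]
    exact ENNReal.toReal_le_of_le_ofReal (by positivity) (not_lt.1 hx)
  have hc : IntegrableOn (fun _ : Dom3 => M) (Metric.closedBall z s) :=
    continuous_const.continuousOn.integrableOn_compact (isCompact_closedBall z s)
  calc ∫ y in Metric.closedBall z s, |u i j y|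
      ≤ ∫ y in Metric.closedBall z s, (M + h y) :=
        integral_mono ((hu i j).abs.continuousOn.integrableOn_compact (isCompact_closedBall z s))
          (hc.add (hint z s)) fun y => huh i j y
    _ = M * (2 * s) ^ 3 + ∫ y in Metric.closedBall z s, h y := by
        rw [integral_add hc (hint z s), setIntegral_const, volume_real_closedBall z hs.le,
          smul_eq_mul, mul_comm]
    _ ≤ M * (2 * s) ^ 3 + ∫ y in Metric.closedBall x (2 * r), h y := by
        refine add_le_add le_rfl ?_
        refine setIntegral_mono_set (hint _ _) (Filter.Eventually.of_forall hh0)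
          (Metric.closedBall_subset_closedBall' ?_).eventuallyLE
        rw [dist_eq_norm]
        linarith
    _ ≤ M * (2 * s) ^ 3 + (2 * s) ^ 3 := by
        gcongr
        exact hx'.trans (pow_le_pow_left₀ hr.le (by linarith) 3)
    _ = _ := by ring

theorem volume_nearBad_le {h : Dom3 → ENNReal} (hh : PeriodicZ3 h) :
    volume (unitBox ∩ ⋃ n, nearBad (fun n => concSet h (dyad n)) n)
      ≤ 60 ^ 3 * (11 ^ 3 * ∫⁻ y in unitBox, h y) := by
  set t : Set (ℕ × Dom3) := {p | 1 ≤ p.1 ∧ p.2 ∈ concSet h (dyad p.1) ∧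
    (Metric.closedBall p.2 (6 * dyad p.1) ∩ unitBox).Nonempty} with ht
  obtain ⟨s, hst, hdisj, hcov⟩ := Vitali.exists_disjoint_subfamily_covering_enlargement_closedBall
    t (fun p => p.2) (fun p => 6 * dyad p.1) 6 (fun p _ => by linarith [dyad_le_one p.1]) 5
    (by norm_num)
  have hs : s.Countable := by
    refine hdisj.countable_of_nonempty_interior fun p _ => ⟨p.2, ?_⟩
    exact Metric.ball_subset_interior_closedBall
      (Metric.mem_ball_self (mul_pos (by norm_num) (dyad_pos p.1)))
  have hsub : unitBox ∩ ⋃ n, nearBad (fun n => concSet h (dyad n)) n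
      ⊆ ⋃ p ∈ s, Metric.closedBall p.2 (5 * (6 * dyad p.1)) := by
    rintro x ⟨hx, hxn⟩
    obtain ⟨n, hn⟩ := mem_iUnion.1 hxn
    obtain ⟨j, -, z, hz, hxz⟩ := exists_bad_of_mem_nearBad hn
    have hxz' : x ∈ Metric.closedBall z (6 * dyad (j + 1)) := by
      rw [Metric.mem_closedBall, dyad_succ]
      linarith [dyad_pos n]
    obtain ⟨p, hp, hsub⟩ := hcov (j + 1, z) ⟨by simp, hz, ⟨x, hxz', hx⟩⟩
    exact mem_biUnion hp (hsub hxz')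
  have hball : ∀ p ∈ s, Metric.closedBall p.2 (2 * dyad p.1) ⊆ Metric.closedBall (0 : Dom3) 5 := by
    intro p hp
    obtain ⟨hp1, -, y, hy, hyb⟩ := hst hp
    have h1 : dyad p.1 ≤ 1 / 2 := by
      have := dyad_anti hp1
      simpa [dyad] using this
    have h2 : ‖y‖ ≤ 1 := (pi_norm_le_iff_of_nonneg zero_le_one).2 fun i => by
      rw [Real.norm_of_nonneg (hyb i trivial).1]
      exact (hyb i trivial).2.le
    refine Metric.closedBall_subset_closedBall' ?_
    rw [Metric.mem_closedBall, dist_comm] at hy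
    have h3 := dist_triangle p.2 y 0
    rw [dist_zero_right y] at h3
    linarith
  have hdisj' : s.PairwiseDisjoint fun p => Metric.closedBall p.2 (2 * dyad p.1) :=
    hdisj.mono fun p => Metric.closedBall_subset_closedBall (by linarith [dyad_pos p.1])
  calc volume (unitBox ∩ ⋃ n, nearBad (fun n => concSet h (dyad n)) n)
      ≤ ∑' p : s, volume (Metric.closedBall p.1.2 (5 * (6 * dyad p.1.1))) :=
        (measure_mono hsub).trans (measure_biUnion_le volume hs _)
    _ ≤ ∑' p : s, 60 ^ 3 * ∫⁻ y in Metric.closedBall p.1.2 (2 * dyad p.1.1), h y := by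
        refine ENNReal.tsum_le_tsum fun p => ?_
        have hd := dyad_pos p.1.1
        rw [Real.volume_pi_closedBall _ (by positivity)]
        calc ENNReal.ofReal ((2 * (5 * (6 * dyad p.1.1))) ^ Fintype.card (Fin 3))
            = 60 ^ 3 * ENNReal.ofReal (dyad p.1.1 ^ 3) := by
              rw [Fintype.card_fin, show (2 * (5 * (6 * dyad p.1.1))) ^ 3
                = 60 ^ 3 * dyad p.1.1 ^ 3 by ring, ENNReal.ofReal_mul (by norm_num)]
              norm_num
          _ ≤ _ := by
              gcongr
              exact (hst p.2).2.1.le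
    _ = 60 ^ 3 * ∫⁻ y in ⋃ p ∈ s, Metric.closedBall p.2 (2 * dyad p.1), h y := by
        rw [ENNReal.tsum_mul_left, lintegral_biUnion hs
          (fun p _ => Metric.isClosed_closedBall.measurableSet) hdisj']
    _ ≤ 60 ^ 3 * ∫⁻ y in Metric.closedBall 0 (5 : ℕ), h y := by
        gcongr
        exact iUnion₂_subset hball
    _ ≤ 60 ^ 3 * (11 ^ 3 * ∫⁻ y in unitBox, h y) := by
        gcongr
        refine (hh.setLIntegral_closedBall_le 0 5).trans_eq ?_
        norm_num

/-! ### Smooth truncation -/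

theorem SmoothPeriodic.exists_lipschitz {f : Dom3 → ℝ} (hf : SmoothPeriodic f) :
    ∃ L, 0 ≤ L ∧ ∀ x y, |f y - f x| ≤ L * ‖y - x‖ := by
  obtain ⟨L, hL0, hL⟩ := hf.2.fderiv.exists_bound (hf.1.continuous_fderiv (by simp))
  exact ⟨L, hL0, fun x y => convex_univ.norm_image_sub_le_of_norm_fderiv_le
    (fun z _ => hf.differentiable z) (fun z _ => hL z) (mem_univ x) (mem_univ y)⟩

theorem tavg_sub {Ω : Type*} [MeasurableSpace Ω] {ν : Measure Ω} [IsFiniteMeasure ν]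
    {a : Ω → ℝ} {e : Ω → Dom3} {f g : Dom3 → ℝ} {A : ℝ} (ha : Measurable a)
    (hA : ∀ ω, |a ω| ≤ A) (he : Measurable e) (hf : SmoothPeriodic f) (hg : SmoothPeriodic g)
    (x : Dom3) : tavg ν a e (fun y => f y - g y) x = tavg ν a e f x - tavg ν a e g x := by
  simp only [tavg, smul_sub]
  exact integral_sub (integrable_tavg ha hA he hf.2 hf.continuous x)
    (integrable_tavg ha hA he hg.2 hg.continuous x)

theorem IsBump.abs_mollify_mollify_sub_le {w f : Dom3 → ℝ} {B L s : ℝ} (hw : IsBump w)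
    (hB : ∀ y, |w y| ≤ B) (hf : SmoothPeriodic f) (hL0 : 0 ≤ L)
    (hL : ∀ x y, |f y - f x| ≤ L * ‖y - x‖) (hs : 0 < s) (x : Dom3) :
    |mollify w s (mollify w s f) x - f x| ≤ (8 * B + 1) * (8 * B * L) * s := by
  have hB0 : 0 ≤ B := (abs_nonneg _).trans (hB 0)
  have hwm := hw.smooth.continuous.measurable
  have hsm := measurable_const_smul (M := ℝ) (α := Dom3) s
  have h1 : ∀ z, |mollify w s f z - f z| ≤ 8 * B * (L * s) := by
    intro z
    have hconst : mollify w s (fun _ => f z) z = f z := by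
      rw [hw.mollify_eq, integral_mul_const, hw.mass, one_mul]
    have e : mollify w s (fun y => f y - f z) z
        = mollify w s f z - mollify w s (fun _ => f z) z :=
      tavg_sub hwm hB hsm hf (SmoothPeriodic.const (f z)) z
    rw [hconst] at e
    rw [← e]
    refine hw.abs_mollify_le_of_ball hB hs (by positivity) fun y hy => (hL z y).trans ?_
    gcongr
    linarith
  have e : mollify w s (fun y => mollify w s f y - f y) x
      = mollify w s (mollify w s f) x - mollify w s f x :=
    tavg_sub hwm hB hsm (hw.smoothPeriodic_mollify hs hf) hf x
  have h2 := hw.abs_mollify_le_of_ball hB hs (S := 8 * B * (L * s)) (by positivity) (x := x)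
    fun z _ => h1 z
  rw [e] at h2
  calc _ ≤ |mollify w s (mollify w s f) x - mollify w s f x| + |mollify w s f x - f x| :=
        abs_sub_le _ _ _
    _ ≤ 8 * B * (8 * B * (L * s)) + 8 * B * (L * s) := add_le_add h2 (h1 x)
    _ = _ := by ring

theorem IsMollifier.exists_common_bound {w : Dom3 → ℝ} (hw : IsMollifier w) :
    ∃ B, (∀ y, |w y| ≤ B) ∧ (∀ m y, |_root_.pd m w y| ≤ B) ∧
      ∀ k l y, |_root_.pd k (_root_.pd l w) y| ≤ B := by
  obtain ⟨B0, h0, hB0⟩ := hw.exists_bound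
  choose B1 h1 hB1 using fun m => (hw.pd m).exists_bound
  choose B2 h2 hB2 using fun k l => ((hw.pd l).pd k).exists_bound
  have hs1 : 0 ≤ ∑ m, B1 m := Finset.sum_nonneg fun m _ => h1 m
  have hs2 : ∀ k, 0 ≤ ∑ l, B2 k l := fun k => Finset.sum_nonneg fun l _ => h2 k l
  have hs3 : 0 ≤ ∑ k, ∑ l, B2 k l := Finset.sum_nonneg fun k _ => hs2 k
  refine ⟨B0 + ∑ m, B1 m + ∑ k, ∑ l, B2 k l, fun y => ?_, fun m y => ?_, fun k l y => ?_⟩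
  · linarith [hB0 y]
  · linarith [hB1 m y, Finset.single_le_sum (fun m _ => h1 m) (Finset.mem_univ m)]
  · linarith [hB2 k l y, Finset.single_le_sum (fun l _ => h2 k l) (Finset.mem_univ l),
      Finset.single_le_sum (fun k _ => hs2 k) (Finset.mem_univ k)]

/-- Smooth truncation: a stress field which is bounded up to a small periodic function `h` is,
up to the double divergence of a potential, bounded, and it changes little except on a set whose
measure is controlled by the integral of `h`. -/
theorem exists_truncation (M : ℝ) : ∃ C, ∀ (u : Fin 3 → Fin 3 → Dom3 → ℝ) (h : Dom3 → ℝ),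
    StressField u → Continuous h → PeriodicZ3 h → (∀ x, 0 ≤ h x) →
    (∀ i j x, |u i j x| ≤ M + h x) → 125 * ∫⁻ y in unitBox, ENNReal.ofReal (h y) ≤ 1 →
    ∀ τ : ℝ, 0 < τ → ∃ R, IsPotential R ∧ (∀ i j x, |u i j x + ddiv R i j x| ≤ C) ∧
      ∃ E : Set Dom3, volume (unitBox ∩ E)
          ≤ 60 ^ 3 * (11 ^ 3 * ∫⁻ y in unitBox, ENNReal.ofReal (h y)) ∧
        ∀ x ∉ E, ∀ i j, |ddiv R i j x| ≤ τ := by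
  obtain ⟨w, hw⟩ := exists_isBump
  obtain ⟨B, hB, hB1, hB2⟩ := hw.exists_common_bound
  have hBn : 0 ≤ B := (abs_nonneg _).trans (hB 0)
  refine ⟨8 * B ^ 2 * (8 * (M + 1)) + 1856 * B ^ 3 * (8 * (M + 1)), ?_⟩
  intro u h hu hh hper hh0 huh hsmall τ hτ
  set H : Dom3 → ENNReal := fun y => ENNReal.ofReal (h y) with hH
  have hHper : PeriodicZ3 H := fun x m => by rw [hH]; beta_reduce; rw [hper x m]
  set bad : ℕ → Set Dom3 := fun n => concSet H (dyad n) with hbad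
  have hbper : ∀ n, ∀ z ∈ bad n, ∀ m : Fin 3 → ℤ, (z + fun i => (m i : ℝ)) ∈ bad n :=
    fun n z hz m => concSet_add_mem hHper hz m
  have hbad0 : bad 0 = ∅ := by
    rw [hbad]
    simpa [dyad] using concSet_one_eq_empty hHper hsmall
  have hav : ∀ n x, x ∉ bad n → AvgBound u (8 * (M + 1)) (dyad n) x := fun n x hx =>
    avgBound_of_notMem_concSet (fun i j => (hu.smooth i j).continuous) hh hh0 huh (dyad_pos n) hx
  choose L hL0 hL using fun i j => (hu.smooth i j).exists_lipschitz
  have hLs : ∀ i j, L i j ≤ ∑ i, ∑ j, L i j := fun i j =>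
    (Finset.single_le_sum (fun j _ => hL0 i j) (Finset.mem_univ j)).trans
      (Finset.single_le_sum (f := fun i => ∑ j, L i j)
        (fun i _ => Finset.sum_nonneg fun j _ => hL0 i j) (Finset.mem_univ i))
  set L' := ∑ i, ∑ j, L i j
  have hL'0 : 0 ≤ L' := (hL0 0 0).trans (hLs 0 0)
  set D := (8 * B + 1) * (8 * B * L')
  have hD : 0 ≤ D := by positivity
  obtain ⟨N, hN⟩ := exists_pow_lt_of_lt_one (show 0 < τ / (D + 1) by positivity)
    (show (1 / 2 : ℝ) < 1 by norm_num)
  have hDN : D * dyad N ≤ τ := by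
    have h1 : dyad N * (D + 1) < τ := (lt_div_iff₀ (by positivity)).1 hN
    nlinarith [dyad_pos N]
  refine ⟨truncPotential w bad u N, hw.isPotential_truncPotential hu hbper N,
    fun i j x => hw.abs_add_ddiv_truncPotential_le hu hbper hbad0 hav hB hB1 hB2 i j x,
    ⋃ n, nearBad bad n, volume_nearBad_le hHper, fun x hx i j => ?_⟩
  have hx' : ∀ n < N, x ∉ nearBad bad n := fun n _ hn => hx (mem_iUnion.2 ⟨n, hn⟩)
  have e := hw.add_ddiv_truncPotential_of_notMem hu hbper hx' i j
  have e' := hw.abs_mollify_mollify_sub_le hB (hu.smooth i j) hL'0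
    (fun x y => (hL i j x y).trans (mul_le_mul_of_nonneg_right (hLs i j) (norm_nonneg _)))
    (dyad_pos N) x
  rw [← e, add_sub_cancel_left] at e'
  exact e'.trans hDN

/-! ### The main theorem -/

theorem stressField_const {ξ : M33} (hξ : IsSym3 ξ) : StressField fun i j _ => ξ (i, j) where
  smooth i j := ⟨contDiff_const, fun _ _ => rfl⟩
  symm i j := funext fun _ => hξ i j
  div i x := by simp [pd]

/-- Points of the `1`-hull are averages of uniformly bounded fields that are close to `K` except
on a set of small measure. -/
theorem exists_bounded_testClass {K : Set M33} (hcomp : IsCompact K) (hne : K.Nonempty) {ξ : M33}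
    (hξ : ξ ∈ hullP K 1) : ∃ C, ∀ δ τ : ℝ, 0 < δ → 0 < τ → ∃ ψ ∈ TestClass,
      (∀ x, ‖ξ + ψ x‖ ≤ C) ∧ ∃ S : Set Dom3, volume (unitBox ∩ S) ≤ ENNReal.ofReal δ ∧
        ∀ x ∉ S, Metric.infDist (ξ + ψ x) K < τ := by
  obtain ⟨hs, hQ⟩ := hξ
  simp only [Real.rpow_one] at hQ
  obtain ⟨M, hM⟩ := hcomp.exists_bound_of_continuousOn (f := id) continuousOn_id
  have hfc : Continuous fun η => Metric.infDist η K := Metric.continuous_infDist_pt K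
  obtain ⟨C, hC⟩ := exists_truncation M
  refine ⟨3 * max C 0, fun δ τ hδ hτ => ?_⟩
  obtain ⟨φ, hφ, hlt⟩ := exists_lt_envelope_add (fun η => Metric.infDist η K) ξ
    (ε := min (1 / 125) (δ / (60 ^ 3 * 11 ^ 3 + 2 / τ))) (by positivity)
  rw [hQ, zero_add, lt_min_iff] at hlt
  obtain ⟨hlt1, hlt2⟩ := hlt
  rw [lt_div_iff₀ (by positivity)] at hlt2
  have hint := integrable_comp_add hfc ξ hφ
  set h : Dom3 → ℝ := fun x => Metric.infDist (ξ + φ x) K with hh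
  have hh0 : ∀ x, 0 ≤ h x := fun x => Metric.infDist_nonneg
  have hhc : Continuous h := hfc.comp (continuous_const.add hφ.1.continuous)
  have hlint : ∫⁻ y in unitBox, ENNReal.ofReal (h y) = ENNReal.ofReal (∫ y in unitBox, h y) :=
    (ofReal_integral_eq_lintegral_ofReal hint (Filter.Eventually.of_forall hh0)).symm
  have hI0 : 0 ≤ ∫ y in unitBox, h y := integral_nonneg hh0
  have hnorm : ∀ x, ‖ξ + φ x‖ ≤ M + h x := fun x => by
    obtain ⟨y, hy, hxy⟩ := hcomp.exists_infDist_eq_dist hne (ξ + φ x)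
    have h1 : ‖y‖ ≤ M := hM y hy
    have h2 := norm_le_norm_add_norm_sub' (ξ + φ x) y
    rw [← dist_eq_norm, ← hxy] at h2
    linarith
  obtain ⟨v, hv, -, hφv⟩ := mem_testClass_iff.1 hφ
  have huh : ∀ i j x, |ξ (i, j) + v i j x| ≤ M + h x := fun i j x => by
    refine le_trans ?_ (hnorm x)
    have := PiLp.norm_apply_le (ξ + φ x) (i, j)
    rwa [hφv] at this ⊢
  have hsmall : 125 * ∫⁻ y in unitBox, ENNReal.ofReal (h y) ≤ 1 := by
    rw [hlint, show (125 : ENNReal) = ENNReal.ofReal 125 by simp,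
      ← ENNReal.ofReal_mul (by positivity), ENNReal.ofReal_le_one]
    linarith
  obtain ⟨R, hR, hRC, E, hE, hRE⟩ := hC _ h ((stressField_const hs).add hv) hhc
    (fun x m => by simp only [hh, hφ.2.1 x m]) hh0 huh hsmall (τ / 6) (by positivity)
  refine ⟨_, add_ddiv_mem_testClass hφ hR, fun x => ?_, E ∪ {x | τ / 2 ≤ h x}, ?_, ?_⟩
  · have e : ξ + (φ x + matrixField (ddiv R) x)
        = matrixField (fun i j x => ξ (i, j) + v i j x + ddiv R i j x) x := by
      rw [← add_assoc, hφv]; rfl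
    rw [e]
    exact norm_matrixField_le (le_max_right _ _) fun i j => (hRC i j x).trans (le_max_left _ _)
  · have hmk : volume (unitBox ∩ {x | τ / 2 ≤ h x})
        ≤ ENNReal.ofReal ((∫ y in unitBox, h y) / (τ / 2)) := by
      have := mul_meas_ge_le_integral_of_nonneg (Filter.Eventually.of_forall hh0) hint (τ / 2)
      rw [inter_comm, ← Measure.restrict_apply (measurableSet_le measurable_const hhc.measurable)]
      refine ENNReal.le_ofReal_iff_toReal_le (measure_ne_top _ _) (by positivity) |>.2 ?_
      rw [le_div_iff₀ (by positivity), mul_comm]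
      exact this
    rw [hlint] at hE
    rw [inter_union_distrib_left]
    calc _ ≤ volume (unitBox ∩ E) + volume (unitBox ∩ {x | τ / 2 ≤ h x}) := measure_union_le _ _
      _ ≤ _ := add_le_add hE hmk
      _ = ENNReal.ofReal ((∫ y in unitBox, h y) * (60 ^ 3 * 11 ^ 3 + 2 / τ)) := by
        rw [show (60 : ENNReal) ^ 3 * (11 ^ 3 * ENNReal.ofReal (∫ y in unitBox, h y))
            = ENNReal.ofReal (60 ^ 3 * (11 ^ 3 * ∫ y in unitBox, h y)) by
          rw [ENNReal.ofReal_mul (by positivity), ENNReal.ofReal_mul (by positivity)]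
          norm_num, ← ENNReal.ofReal_add (by positivity) (by positivity)]
        congr 1
        field_simp
      _ ≤ _ := ENNReal.ofReal_le_ofReal hlt2.le
  · intro x hx
    rw [mem_union, not_or] at hx
    have h1 : h x < τ / 2 := not_le.1 hx.2
    have h2 : ‖matrixField (ddiv R) x‖ ≤ 3 * (τ / 6) :=
      norm_matrixField_le (by positivity) fun i j => hRE x hx.1 i j
    have h3 := (Metric.lipschitz_infDist_pt K).le_add_norm
      (ξ + (φ x + matrixField (ddiv R) x)) (ξ + φ x)
    rw [show ξ + (φ x + matrixField (ddiv R) x) - (ξ + φ x) = matrixField (ddiv R) x by abel]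
      at h3
    change _ ≤ h x + _ at h3
    linarith

theorem setIntegral_unitBox_le {f : Dom3 → ℝ} (hf : Integrable f (volume.restrict unitBox))
    {a b δ : ℝ} {S : Set Dom3} (hb : ∀ x, f x ≤ a + b) (ha : ∀ x ∉ S, f x ≤ a) (hb0 : 0 ≤ b)
    (hδ : 0 ≤ δ) (hS : volume (unitBox ∩ S) ≤ ENNReal.ofReal δ) :
    ∫ x in unitBox, f x ≤ a + b * δ := by
  set T := toMeasurable volume (unitBox ∩ S)
  have hT : MeasurableSet T := measurableSet_toMeasurable _ _
  have hTδ : (volume.restrict unitBox).real T ≤ δ := by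
    refine ENNReal.toReal_le_of_le_ofReal hδ ((Measure.restrict_apply_le _ _).trans ?_)
    rwa [measure_toMeasurable]
  have hi : Integrable (T.indicator fun _ => b) (volume.restrict unitBox) :=
    (integrable_const b).indicator hT
  calc ∫ x in unitBox, f x ≤ ∫ x in unitBox, (a + T.indicator (fun _ => b) x) := by
        refine setIntegral_mono_on hf ((integrable_const a).add hi) measurableSet_unitBox
          fun x hx => ?_
        by_cases hxS : x ∈ S
        · rw [indicator_of_mem (subset_toMeasurable volume (unitBox ∩ S) ⟨hx, hxS⟩ : x ∈ T)]
          exact hb x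
        · exact (ha x hxS).trans (le_add_of_nonneg_right (indicator_nonneg (fun _ _ => hb0) x))
    _ = a + b * (volume.restrict unitBox).real T := by
        rw [integral_add (integrable_const a) hi, integral_indicator hT]
        simp [mul_comm]
    _ ≤ a + b * δ := by gcongr

/-- Quasiconvex functions are tested with the truncated fields. -/
theorem hullP_one_subset_hullInf {K : Set M33} (hcomp : IsCompact K) (hne : K.Nonempty) :
    hullP K 1 ⊆ hullInf K := by
  intro ξ hξ
  refine ⟨hξ.1, fun g hg hg0 hqc => ?_⟩
  obtain ⟨C, hC⟩ := exists_bounded_testClass hcomp hne hξ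
  obtain ⟨G, hG⟩ := (isCompact_closedBall (0 : M33) C).exists_bound_of_continuousOn hg.continuousOn
  have hm : ∀ η ∈ K, g η ≤ sSup (g '' K) := fun η hη =>
    le_csSup (hcomp.image hg).bddAbove (mem_image_of_mem g hη)
  set m := sSup (g '' K)
  have hm0 : 0 ≤ m := (hg0 _).trans (hm _ hne.some_mem)
  refine le_of_forall_pos_le_add fun ε hε => ?_
  obtain ⟨τ, hτ, hτK⟩ := hcomp.exists_thickening_subset_open
    (isOpen_Iio.preimage hg : IsOpen (g ⁻¹' Iio (m + ε / 2)))
    fun η hη => (hm η hη).trans_lt (by linarith)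
  obtain ⟨ψ, hψ, hψC, S, hS, hψS⟩ := hC (ε / 2 / (max G 0 + 1)) τ (by positivity) hτ
  have key := setIntegral_unitBox_le (a := m + ε / 2) (b := max G 0) (integrable_comp_add hg ξ hψ)
    (fun x => ?_) (fun x hx => ?_) (le_max_right _ _) (by positivity) hS
  · have : max G 0 * (ε / 2 / (max G 0 + 1)) ≤ ε / 2 := by
      rw [mul_div_left_comm]
      exact mul_le_of_le_one_right (by positivity)
        ((div_le_one (by positivity)).2 (by linarith))
    linarith [hqc ξ hξ.1 ψ hψ]
  · have h1 : g (ξ + ψ x) ≤ G := (le_abs_self _).trans (hG _ (by simpa using hψC x))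
    linarith [le_max_left G 0]
  · refine le_of_lt (hτK ?_)
    rw [Metric.mem_thickening_iff_infDist_lt hne]
    exact hψS x hx

/-- For every non-empty compact `K ⊆ Sym(3)`, the 1-symmetric
div-quasiconvex hull coincides with the ∞-symmetric div-quasiconvex hull. -/
theorem symmetric_divQC_hull_one_eq_infty (K : Set M33) (hne : K.Nonempty)
    (hcomp : IsCompact K) (hsym : ∀ A ∈ K, IsSym3 A) :
    hullP K 1 = hullInf K := by
  exact Set.Subset.antisymm (hullP_one_subset_hullInf hcomp hne) (hullInf_subset_hullP_one hne)
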